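/- arXiv:1505.07176 — 7 statements merged into one kernel-verified Lean document; each statement's English description precedes it below -/
import Mathlib

section
/- Let b ≥ 2 be an integer, m, s ∈ ℕ, and let 𝒫 be the digital net over ℤ_b in G^s with generating matrices C₁,…,C_s ∈ ℤ_b^{ℕ×m}. Then the symmetrized point set 𝒫^sym is again a digital net over ℤ_b in G^s: as a multiset, 𝒫^sym equals the digital net with generating matrices D₁,…,D_s ∈ ℤ_b^{ℕ×(m+s)}, where D_j = (C_j, E_j) and E_j ∈ ℤ_b^{ℕ×s} is the matrix whose j-th column has every entry equal to 1 and all other entries equal to 0. -/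
open MeasureTheory

noncomputable section

namespace Sym

/-! ### The group `G = (ℤ_b)^ℕ` and its normalized Haar (= product) measure -/

instance (b : ℕ) : TopologicalSpace (ZMod b) := ⊥
instance (b : ℕ) : DiscreteTopology (ZMod b) := ⟨rfl⟩
instance (b : ℕ) : MeasurableSpace (ZMod b) := ⊤
instance (b : ℕ) : BorelSpace (ZMod b) :=
  ⟨(borel_eq_top_of_discrete (α := ZMod b)).symm⟩

/-- `G = (ℤ_b)^ℕ`, the compact totally disconnected abelian group of `ℤ_b`-valued
sequences with componentwise addition modulo `b`. -/
abbrev G (b : ℕ) := ℕ → ZMod b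

/-- The product measure `ν` on `G`, realized as the normalized Haar measure of the
compact group `G` (which is the product of the uniform probability measures on `ℤ_b`). -/
def nu (b : ℕ) [NeZero b] : Measure (G b) :=
  Measure.addHaarMeasure (⊤ : TopologicalSpace.PositiveCompacts (G b))

/-- The product measure on `G^s`. -/
def nuS (b : ℕ) [NeZero b] (s : ℕ) : Measure (Fin s → G b) :=
  Measure.pi fun _ : Fin s => nu b

/-! ### b-adic digits, characters, projection, section, Walsh functions -/

/-- the `i`-th `b`-adic digit of `k` (`i = 0,1,2,...`). -/
def dgt (b k i : ℕ) : ℕ := k / b ^ i % b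

/-- the `i`-th `b`-adic digit of `k`, as an element of `ℤ_b`. -/
def zdgt (b k i : ℕ) : ZMod b := (dgt b k i : ZMod b)

/-- the `b`-adic digit sum `δ(k)` of `k`. -/
def dsum (b k : ℕ) : ℕ := ∑ i ∈ Finset.range k, dgt b k i

/-- `k ∈ 𝓔`, i.e. the `b`-adic digit sum of `k` is `≡ 0 (mod b)`. -/
def inE (b k : ℕ) : Prop := dsum b k % b = 0

/-- The `k`-th character `W_k : G → ℂ`,
`W_k(z) = ω^(κ₀ζ₁ + ⋯ + κ_{a-1}ζ_a)` with `ω = exp(2π√-1/b)`. -/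
def W (b k : ℕ) (z : G b) : ℂ :=
  Complex.exp (2 * Real.pi * Complex.I *
    (∑ i ∈ Finset.range k, (dgt b k i : ℝ) * ((z i).val : ℝ)) / b)

/-- The `k`-th character on `G^s`. -/
def WS (b s : ℕ) (k : Fin s → ℕ) (z : Fin s → G b) : ℂ :=
  ∏ j, W b (k j) (z j)

/-- The projection `π : G → [0,1]`, `π(z) = ∑_{i≥1} ζ_i b^{-i}`. -/
def projG (b : ℕ) (z : G b) : ℝ := ∑' i : ℕ, ((z i).val : ℝ) / b ^ (i + 1)

/-- The componentwise projection `π : G^s → [0,1]^s`. -/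
def projS (b s : ℕ) (z : Fin s → G b) : Fin s → ℝ := fun j => projG b (z j)

/-- The section `σ : [0,1] → G`, sending `x` to the digits of its unique `b`-adic
expansion with infinitely many digits `≠ b-1` (all digits `b-1` for `x = 1`). -/
def secG (b : ℕ) (x : ℝ) : G b := fun i =>
  if x = 1 then (-1 : ZMod b) else ((⌊x * (b : ℝ) ^ (i + 1)⌋ : ℤ) : ZMod b)

/-- The componentwise section `σ : [0,1]^s → G^s`. -/
def secS (b s : ℕ) (x : Fin s → ℝ) : Fin s → G b := fun j => secG b (x j)

/-- The unit cube `[0,1]^s`. -/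
def cube (s : ℕ) : Set (Fin s → ℝ) := Set.Icc 0 1

/-- The `k`-th `b`-adic Walsh function on `[0,1]^s`, `wal_k(x) = W_k(σ(x))`. -/
def walS (b s : ℕ) (k : Fin s → ℕ) (x : Fin s → ℝ) : ℂ := WS b s k (secS b s x)

/-- The `(k,l)`-th Walsh coefficient of a kernel `K`. -/
def Khat (b s : ℕ) (K : (Fin s → ℝ) → (Fin s → ℝ) → ℝ) (k l : Fin s → ℕ) : ℂ :=
  ∫ x in cube s, ∫ y in cube s,
    (K x y : ℂ) * (starRingEnd ℂ) (walS b s k x) * walS b s l y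

/-! ### Digital nets -/

/-- The point `z_n` of the digital net with generating matrices `C₁,…,C_s ∈ ℤ_b^{ℕ×m}`:
its `j`-th component is `(ν₀,…,ν_{m-1})·C_j^⊤ ∈ G` where `n = ∑ ν_i b^i`. -/
def netPt (b m s : ℕ) (C : Fin s → ℕ → Fin m → ZMod b) (n : ℕ) : Fin s → G b :=
  fun j i => ∑ t : Fin m, zdgt b n t * C j i t

/-- The digital net over `ℤ_b` in `G^s` with generating matrices `C₁,…,C_s`, as a
multiset (points counted with multiplicity). -/
def netMS (b m s : ℕ) (C : Fin s → ℕ → Fin m → ZMod b) : Multiset (Fin s → G b) :=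
  (Multiset.range (b ^ m)).map (netPt b m s C)

/-- membership in the dual net: `k⃗₁C₁ ⊕ ⋯ ⊕ k⃗_sC_s = 0 ∈ ℤ_b^m`. -/
def inDual (b m s : ℕ) (C : Fin s → ℕ → Fin m → ZMod b) (k : Fin s → ℕ) : Prop :=
  ∀ t : Fin m, ∑ j, ∑ i ∈ Finset.range (k j), zdgt b (k j) i * C j i t = 0

/-- `e_l = (e_{l₁},…,e_{l_s}) ∈ G^s` where `e_{l_j} = (l_j, l_j, …) ∈ G`. -/
def ept (b s : ℕ) (l : Fin s → ZMod b) : Fin s → G b := fun j _ => l j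

/-- The symmetrized point set `𝒫^sym = {z ⊕ e_l : z ∈ 𝒫, l ∈ ℤ_b^s}` of a multiset
`𝒫 ⊂ G^s`. -/
def symMS (b s : ℕ) [NeZero b] (P : Multiset (Fin s → G b)) : Multiset (Fin s → G b) :=
  P.bind fun z => (Finset.univ : Finset (Fin s → ZMod b)).val.map fun l => z + ept b s l

/-- The generating matrices `D_j = (C_j, E_j)` of the symmetrized digital net, where the
`j`-th column of `E_j ∈ ℤ_b^{ℕ×s}` is all ones and its other entries vanish. -/
def symMat (b m s : ℕ) (C : Fin s → ℕ → Fin m → ZMod b) (j : Fin s) (i : ℕ)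
    (t : Fin (m + s)) : ZMod b :=
  if h : (t : ℕ) < m then C j i ⟨t, h⟩ else if (t : ℕ) = m + j then 1 else 0

/-- The symmetrized digital net `π(𝒫^sym) ⊂ [0,1]^s` of the digital net with generating
matrices `C₁,…,C_s`, as a multiset of points of `[0,1]^s`. -/
def symNetPts (b m s : ℕ) [NeZero b] (C : Fin s → ℕ → Fin m → ZMod b) :
    Multiset (Fin s → ℝ) :=
  (symMS b s (netMS b m s C)).map (projS b s)

/-! ### Worst-case error, digital shift -/

/-- The squared worst-case error
`e²(P,K) = ∫∫K − (2/|P|) ∑_{x∈P} ∫ K(x,y)dy + (1/|P|²) ∑_{x,y∈P} K(x,y)`. -/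
def sqErr (s : ℕ) (P : Multiset (Fin s → ℝ)) (K : (Fin s → ℝ) → (Fin s → ℝ) → ℝ) : ℝ :=
  (∫ x in cube s, ∫ y in cube s, K x y)
    - 2 / (P.card : ℝ) * (P.map fun x => ∫ y in cube s, K x y).sum
    + 1 / (P.card : ℝ) ^ 2 * (P.map fun x => (P.map fun y => K x y).sum).sum

/-- The `b`-adic digital shift `x ⊕ y := π(σ(x) ⊕ σ(y))` on `[0,1]^s`. -/
def dshiftS (b s : ℕ) (x y : Fin s → ℝ) : Fin s → ℝ :=
  fun j => projG b (secG b (x j) + secG b (y j))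

/-- The digital shift invariant kernel `K_ds(x,y) = ∫_{[0,1]^s} K(x⊕σ̃, y⊕σ̃) dσ̃`. -/
def Kds (b s : ℕ) (K : (Fin s → ℝ) → (Fin s → ℝ) → ℝ) (x y : Fin s → ℝ) : ℝ :=
  ∫ t in cube s, K (dshiftS b s x t) (dshiftS b s y t)

/-! ### Two-dimensional discrepancy and the Dick weight -/

/-- The local discrepancy `Δ(t;P)` of a finite multiset `P ⊂ [0,1]²`. -/
def disc2 (P : Multiset (ℝ × ℝ)) (t : ℝ × ℝ) : ℝ :=
  (P.map fun x => if 0 ≤ x.1 ∧ x.1 < t.1 ∧ 0 ≤ x.2 ∧ x.2 < t.2 then (1 : ℝ) else 0).sum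
      / (P.card : ℝ)
    - t.1 * t.2

/-- The `L_p` discrepancy of a finite multiset `P ⊂ [0,1]²`. -/
def LpDisc (p : ℝ) (P : Multiset (ℝ × ℝ)) : ℝ :=
  (∫ t in Set.Icc ((0 : ℝ), (0 : ℝ)) (1, 1), |disc2 P t| ^ p) ^ (1 / p)

/-- The Dick weight `μ₂(k) = a₁ + a₂` (resp. `a₁`, `0`), where `a₁ > a₂` are the positions
of the two highest nonzero `b`-adic digits of `k`. -/
def mu2 (b k : ℕ) : ℕ :=
  if k = 0 then 0
  else Nat.log b k + 1 +
    (if k % b ^ Nat.log b k = 0 then 0 else Nat.log b (k % b ^ Nat.log b k) + 1)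

end Sym

open MeasureTheory Sym

open scoped Classical

noncomputable section

/-- The equivalence between `{0,…,b^m-1}` and digit vectors over `ℤ_b`. -/
def Sym.digitEquiv (b m : ℕ) [NeZero b] : Fin (b ^ m) ≃ (Fin m → ZMod b) :=
  finFunctionFinEquiv.symm.trans (Equiv.arrowCongr (Equiv.refl _) (ZMod.finEquiv b).toEquiv)

theorem Sym.digitEquiv_apply (b m : ℕ) [NeZero b] (n : Fin (b ^ m)) (t : Fin m) :
    digitEquiv b m n t = zdgt b n t := by
  have h (x : Fin b) : ZMod.finEquiv b x = ((x : ℕ) : ZMod b) := by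
    obtain ⟨k, rfl⟩ := Nat.exists_eq_succ_of_ne_zero (NeZero.ne b)
    exact (Fin.cast_val_eq_self x).symm
  simp [digitEquiv, zdgt, dgt, Equiv.arrowCongr, h, finFunctionFinEquiv]

theorem Sym.netMS_eq_map_univ (b m s : ℕ) [NeZero b] (C : Fin s → ℕ → Fin m → ZMod b) :
    netMS b m s C = (Finset.univ : Finset (Fin m → ZMod b)).val.map
      fun v j i => ∑ t, v t * C j i t := by
  have hrange : Multiset.range (b ^ m) =
      (Finset.univ : Finset (Fin (b ^ m))).val.map Fin.val := by
    have := congrArg Finset.val (Fin.map_valEmbedding_univ (n := b ^ m))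
    rw [Nat.Iio_eq_range] at this
    exact this.symm
  have huniv : (Finset.univ : Finset (Fin m → ZMod b)).val =
      (Finset.univ : Finset (Fin (b ^ m))).val.map (digitEquiv b m) :=
    (congrArg Finset.val (Finset.map_univ_equiv (digitEquiv b m))).symm
  rw [netMS, hrange, huniv, Multiset.map_map, Multiset.map_map]
  refine Multiset.map_congr rfl fun n _ => ?_
  funext j i
  simp [netPt, digitEquiv_apply]

theorem Sym.sum_append_mul_symMat (b m s : ℕ) (C : Fin s → ℕ → Fin m → ZMod b)
    (v : Fin m → ZMod b) (l : Fin s → ZMod b) (j : Fin s) (i : ℕ) :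
    ∑ t, Fin.append v l t * symMat b m s C j i t = ∑ t, v t * C j i t + l j := by
  simp [Fin.sum_univ_add, symMat, Fin.val_inj]

-- STATEMENT 5
theorem stmt5 (b : ℕ) (hb : 2 ≤ b) [NeZero b] (m s : ℕ) (hm : 1 ≤ m) (hs : 1 ≤ s)
    (C : Fin s → ℕ → Fin m → ZMod b) :
    symMS b s (netMS b m s C) = netMS b (m + s) s (symMat b m s C) := by
  have huniv : (Finset.univ : Finset (Fin (m + s) → ZMod b)).val =
      ((Finset.univ : Finset (Fin m → ZMod b)).val ×ˢ
        (Finset.univ : Finset (Fin s → ZMod b)).val).map (Fin.appendEquiv m s) :=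
    (congrArg Finset.val (Finset.map_univ_equiv
      (Fin.appendEquiv (α := ZMod b) m s))).symm
  rw [netMS_eq_map_univ, netMS_eq_map_univ, huniv, symMS, Multiset.bind_map,
    Multiset.map_map]
  change _ = Multiset.map _ (Multiset.product _ _)
  rw [Multiset.product, Multiset.map_bind]
  refine Multiset.bind_congr fun v _ => ?_
  rw [Multiset.map_map]
  refine Multiset.map_congr rfl fun l _ => ?_
  funext j i
  exact (sum_append_mul_symMat b m s C v l j i).symm

end
end
end

section
/- Let b ≥ 2 be an integer, m, s ∈ ℕ, let 𝒫 be the digital net over ℤ_b in G^s with generating matrices C₁,…,C_s ∈ ℤ_b^{ℕ×m} and dual net 𝒫^⊥, and let 𝒫^sym be its symmetrized point set. For every k ∈ ℕ₀^s, the character sum ∑_{z ∈ 𝒫^sym} W_k(z) (counted with multiplicity, i.e., ∑_{z∈𝒫} ∑_{l∈ℤ_b^s} W_k(z ⊕ e_l)) equals |𝒫^sym| = b^{m+s} if k ∈ 𝒫^⊥ ∩ 𝓔^s, and equals 0 otherwise. -/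
open MeasureTheory

noncomputable section

open MeasureTheory Sym

open scoped Classical

noncomputable section

namespace Sym

lemma addChar_map_sum {ι A M : Type*} [AddCommMonoid A] [CommMonoid M] (ψ : AddChar A M)
    (t : Finset ι) (f : ι → A) : ψ (∑ i ∈ t, f i) = ∏ i ∈ t, ψ (f i) :=
  map_prod ψ.toMonoidHom (fun i => Multiplicative.ofAdd (f i)) t

/-- Sums of the standard additive character over a coordinate space of `ℤ_b` detect the zero
linear form. -/
lemma sum_stdAddChar_dotProduct {ι : Type*} [Fintype ι] [DecidableEq ι] (b : ℕ) [NeZero b]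
    (a : ι → ZMod b) :
    ∑ v : ι → ZMod b, ZMod.stdAddChar (∑ i, v i * a i)
      = if ∀ i, a i = 0 then (b : ℂ) ^ Fintype.card ι else 0 := by
  have hchar (v : ι → ZMod b) :
      (ZMod.stdAddChar (∑ i, v i * a i) : ℂ) = ∏ i, ZMod.stdAddChar (v i * a i) :=
    addChar_map_sum _ _ _
  simp_rw [hchar]
  rw [← Fintype.prod_sum (fun i x => (ZMod.stdAddChar (x * a i) : ℂ))]
  simp_rw [AddChar.sum_mulShift _ (ZMod.isPrimitive_stdAddChar b), ZMod.card]
  split_ifs with h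
  · simp [h]
  · push Not at h
    obtain ⟨i, hi⟩ := h
    exact Finset.prod_eq_zero (Finset.mem_univ i) (by simp [hi])

/-- The first `m` digits identify `{0, …, b ^ m - 1}` with `ℤ_b ^ m`. -/
lemma bijective_zdgt (b m : ℕ) [NeZero b] :
    Function.Bijective fun (n : Fin (b ^ m)) (t : Fin m) => zdgt b n t := by
  refine (Fintype.bijective_iff_surjective_and_card _).2 ⟨fun v => ?_, by simp [ZMod.card]⟩
  let d : Fin m → Fin b := fun t => ⟨(v t).val, ZMod.val_lt _⟩
  refine ⟨finFunctionFinEquiv d, funext fun t => ?_⟩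
  have h : dgt b (finFunctionFinEquiv d) t = (v t).val :=
    congrArg Fin.val (congrFun (finFunctionFinEquiv.symm_apply_apply d) t)
  change ((dgt b (finFunctionFinEquiv d) t : ℕ) : ZMod b) = v t
  rw [h, ZMod.natCast_zmod_val]

lemma W_eq_stdAddChar (b k : ℕ) [NeZero b] (z : G b) :
    W b k z = ZMod.stdAddChar (∑ i ∈ Finset.range k, zdgt b k i * z i) := by
  have h : ∑ i ∈ Finset.range k, zdgt b k i * z i
      = ((∑ i ∈ Finset.range k, (dgt b k i : ℤ) * ((z i).val : ℤ) : ℤ) : ZMod b) := by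
    simp [zdgt]
  rw [h, ZMod.stdAddChar_coe, W]
  push_cast
  rfl

lemma WS_eq_stdAddChar (b s : ℕ) [NeZero b] (k : Fin s → ℕ) (z : Fin s → G b) :
    WS b s k z
      = ZMod.stdAddChar (∑ j, ∑ i ∈ Finset.range (k j), zdgt b (k j) i * z j i) := by
  simp_rw [WS, W_eq_stdAddChar]
  exact (addChar_map_sum _ _ _).symm

lemma inE_iff (b k : ℕ) : inE b k ↔ ∑ i ∈ Finset.range k, zdgt b k i = 0 := by
  rw [inE, ← Nat.dvd_iff_mod_eq_zero, ← ZMod.natCast_eq_zero_iff, dsum, Nat.cast_sum]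
  rfl

lemma WS_netPt_add_ept (b m s : ℕ) [NeZero b] (C : Fin s → ℕ → Fin m → ZMod b)
    (k : Fin s → ℕ) (n : ℕ) (l : Fin s → ZMod b) :
    WS b s k (netPt b m s C n + ept b s l)
      = ZMod.stdAddChar (∑ t : Fin m, zdgt b n t *
            ∑ j, ∑ i ∈ Finset.range (k j), zdgt b (k j) i * C j i t)
        * ZMod.stdAddChar (∑ j, l j * ∑ i ∈ Finset.range (k j), zdgt b (k j) i) := by
  rw [WS_eq_stdAddChar, ← AddChar.map_add_eq_mul]
  congr 1
  simp only [Pi.add_apply, netPt, ept, mul_add, Finset.sum_add_distrib, Finset.mul_sum]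
  congr 1
  · rw [Finset.sum_comm]
    refine Finset.sum_congr rfl fun j _ => ?_
    rw [Finset.sum_comm]
    exact Finset.sum_congr rfl fun t _ => Finset.sum_congr rfl fun i _ => mul_left_comm _ _ _
  · exact Finset.sum_congr rfl fun j _ => Finset.sum_congr rfl fun i _ => mul_comm _ _

end Sym

-- STATEMENT 7
theorem stmt7 (b : ℕ) (hb : 2 ≤ b) [NeZero b] (m s : ℕ) (hm : 1 ≤ m) (hs : 1 ≤ s)
    (C : Fin s → ℕ → Fin m → ZMod b) (k : Fin s → ℕ) :
    ∑ n ∈ Finset.range (b ^ m), ∑ l : Fin s → ZMod b,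
        WS b s k (netPt b m s C n + ept b s l)
      = if inDual b m s C k ∧ ∀ j, inE b (k j) then ((b : ℂ) ^ (m + s)) else 0 := by
  simp_rw [WS_netPt_add_ept, ← Finset.mul_sum, ← Finset.sum_mul]
  rw [sum_stdAddChar_dotProduct, Finset.sum_range,
    Function.Bijective.sum_comp (bijective_zdgt b m) fun v : Fin m → ZMod b =>
      (ZMod.stdAddChar (∑ t, v t *
        ∑ j, ∑ i ∈ Finset.range (k j), zdgt b (k j) i * C j i t) : ℂ),
    sum_stdAddChar_dotProduct]
  simp only [inE_iff, inDual, Fintype.card_fin, ite_and, pow_add, mul_ite, ite_mul, mul_zero,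
    zero_mul]
  split_ifs <;> rfl

end
end
end

section
/- Let b ≥ 2 be an integer, m, s ∈ ℕ, and let 𝒫 be the digital net over ℤ_b in G^s with generating matrices C₁,…,C_s ∈ ℤ_b^{ℕ×m} and dual net 𝒫^⊥. Let 𝒫^sym be the symmetrized point set of 𝒫, viewed as the digital net with generating matrices D_j = (C_j, E_j) ∈ ℤ_b^{ℕ×(m+s)}, where E_j is the matrix whose j-th column has every entry 1 and all other entries 0. Then the dual net of 𝒫^sym satisfies (𝒫^sym)^⊥ = 𝒫^⊥ ∩ 𝓔^s. -/
open MeasureTheory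

noncomputable section

open MeasureTheory Sym

open scoped Classical

noncomputable section

theorem inE_iff_sum_zdgt_eq_zero (b k : ℕ) :
    inE b k ↔ ∑ i ∈ Finset.range k, zdgt b k i = 0 := by
  unfold inE dsum zdgt
  rw [← Nat.cast_sum, ZMod.natCast_eq_zero_iff, Nat.dvd_iff_mod_eq_zero]

theorem symMat_castAdd (b m s : ℕ) (C : Fin s → ℕ → Fin m → ZMod b) (j : Fin s) (i : ℕ)
    (t : Fin m) : symMat b m s C j i (Fin.castAdd s t) = C j i t := by
  simp [symMat]

theorem symMat_natAdd (b m s : ℕ) (C : Fin s → ℕ → Fin m → ZMod b) (j : Fin s) (i : ℕ)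
    (t : Fin s) : symMat b m s C j i (Fin.natAdd m t) = if j = t then 1 else 0 := by
  simp [symMat, Fin.ext_iff, eq_comm]

theorem sum_zdgt_mul_symMat_natAdd (b m s : ℕ) (C : Fin s → ℕ → Fin m → ZMod b)
    (k : Fin s → ℕ) (t : Fin s) :
    ∑ j, ∑ i ∈ Finset.range (k j), zdgt b (k j) i * symMat b m s C j i (Fin.natAdd m t) =
      ∑ i ∈ Finset.range (k t), zdgt b (k t) i := by
  rw [Finset.sum_eq_single t]
  · simp [symMat_natAdd]
  · intro j _ hj
    simp [symMat_natAdd, hj]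
  · simp

-- STATEMENT 8
theorem stmt8 (b : ℕ) (hb : 2 ≤ b) (m s : ℕ) (hm : 1 ≤ m) (hs : 1 ≤ s)
    (C : Fin s → ℕ → Fin m → ZMod b) (k : Fin s → ℕ) :
    inDual b (m + s) s (symMat b m s C) k ↔ inDual b m s C k ∧ ∀ j, inE b (k j) := by
  simp only [inE_iff_sum_zdgt_eq_zero, inDual, Fin.forall_fin_add, symMat_castAdd,
    sum_zdgt_mul_symMat_natAdd]

end
end
end

section
/- Let b ≥ 2 be an integer, m, s ∈ ℕ, let 𝒫 be the digital net over ℤ_b in G^s with generating matrices C₁,…,C_s ∈ ℤ_b^{ℕ×m} and dual net 𝒫^⊥, and let 𝒫^sym be its symmetrized point set. Let K : [0,1]^s × [0,1]^s → ℝ be continuous and symmetric (K(x,y) = K(y,x)) with ∑_{k,l ∈ ℕ₀^s} |K̂(k,l)| < ∞. Then the squared worst-case error of QMC integration over π(𝒫^sym) satisfies e²(π(𝒫^sym), K) = ∑_{k,l ∈ 𝒫^⊥ ∩ 𝓔^s, k ≠ 0, l ≠ 0} K̂(k,l). -/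
open MeasureTheory

noncomputable section

open MeasureTheory Sym

open scoped Classical

noncomputable section

theorem Sym.zdgt_eq_zero_of_lt {b k i N : ℕ} (hb : 2 ≤ b) (hk : k < b ^ N) (hi : N ≤ i) :
    zdgt b k i = 0 := by
  have : k / b ^ i = 0 := Nat.div_eq_of_lt (hk.trans_le (Nat.pow_le_pow_right (by omega) hi))
  simp [zdgt, dgt, this]

/-- The digit sums occurring in `W` and `inDual` may be extended beyond the digits of `k`. -/
theorem Sym.sum_range_zdgt_mul {b k N : ℕ} (hb : 2 ≤ b) (hk : k < b ^ N) (c : ℕ → ZMod b) :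
    ∑ i ∈ Finset.range k, zdgt b k i * c i = ∑ i : Fin N, zdgt b k i * c i := by
  rw [Fin.sum_univ_eq_sum_range (fun i => zdgt b k i * c i) N]
  have key : ∀ M, k < b ^ M → ∑ i ∈ Finset.range M, zdgt b k i * c i
      = ∑ i ∈ Finset.range (max k N), zdgt b k i * c i ∨ max k N < M := by
    intro M hM
    by_cases h : M ≤ max k N
    · left
      refine Finset.sum_subset (Finset.range_mono h) fun i _ hi => ?_
      rw [zdgt_eq_zero_of_lt hb hM (by simpa using hi), zero_mul]
    · right; omega
  have h1 := (key k (Nat.lt_pow_self hb)).resolve_right (by simp)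
  have h2 := (key N hk).resolve_right (by simp)
  rw [h1, h2]

theorem Sym.W_eq_stdAddChar_s10 {b : ℕ} [NeZero b] (k : ℕ) (z : G b) :
    W b k z = ZMod.stdAddChar (∑ i ∈ Finset.range k, zdgt b k i * z i) := by
  have : (∑ i ∈ Finset.range k, zdgt b k i * z i)
      = (((∑ i ∈ Finset.range k, (dgt b k i : ℤ) * ((z i).val : ℤ)) : ℤ) : ZMod b) := by
    push_cast
    refine Finset.sum_congr rfl fun i _ => ?_
    simp [zdgt]
  rw [this, ZMod.stdAddChar_coe, W]
  push_cast
  rfl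

theorem Sym.W_zero {b : ℕ} (z : G b) : W b 0 z = 1 := by simp [W]

theorem Sym.WS_zero {b s : ℕ} (z : Fin s → G b) : WS b s 0 z = 1 := by simp [WS, W_zero]

theorem Sym.norm_W {b : ℕ} [NeZero b] (k : ℕ) (z : G b) : ‖W b k z‖ = 1 := by
  rw [W_eq_stdAddChar_s10, AddChar.norm_apply]

theorem Sym.norm_WS {b s : ℕ} [NeZero b] (k : Fin s → ℕ) (z : Fin s → G b) :
    ‖WS b s k z‖ = 1 := by
  simp [WS, norm_W]

theorem Sym.WS_eq_stdAddChar_s10 {b s : ℕ} [NeZero b] (k : Fin s → ℕ) (z : Fin s → G b) :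
    WS b s k z
      = ZMod.stdAddChar (∑ j, ∑ i ∈ Finset.range (k j), zdgt b (k j) i * z j i) := by
  simp only [WS, W_eq_stdAddChar_s10]
  exact (map_prod (ZMod.stdAddChar (N := b)).toMonoidHom (fun j => Multiplicative.ofAdd
    (∑ i ∈ Finset.range (k j), zdgt b (k j) i * z j i)) Finset.univ).symm

theorem Sym.W_add {b : ℕ} [NeZero b] (k : ℕ) (z w : G b) :
    W b k (z + w) = W b k z * W b k w := by
  simp only [W_eq_stdAddChar_s10, ← AddChar.map_add_eq_mul, ← Finset.sum_add_distrib, Pi.add_apply,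
    mul_add]

theorem Sym.WS_add {b s : ℕ} [NeZero b] (k : Fin s → ℕ) (z w : Fin s → G b) :
    WS b s k (z + w) = WS b s k z * WS b s k w := by
  simp [WS, W_add, Finset.prod_mul_distrib]

theorem Sym.W_mul_conj {b : ℕ} [NeZero b] (k : ℕ) (z w : G b) :
    W b k z * (starRingEnd ℂ) (W b k w) = W b k (z - w) := by
  have h : W b k (z - w) * W b k w = W b k z := by rw [← W_add, sub_add_cancel]
  rw [← h, mul_assoc, Complex.mul_conj, Complex.normSq_eq_norm_sq, norm_W]
  simp

theorem Sym.sum_pi_stdAddChar {b : ℕ} [NeZero b] {ι : Type*} [Fintype ι] [DecidableEq ι]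
    (c : ι → ZMod b) :
    ∑ d : ι → ZMod b, (ZMod.stdAddChar (∑ t, d t * c t) : ℂ)
      = if c = 0 then (b : ℂ) ^ Fintype.card ι else 0 := by
  have h1 : ∀ d : ι → ZMod b, (ZMod.stdAddChar (∑ t, d t * c t) : ℂ)
      = ∏ t, ZMod.stdAddChar (d t * c t) := fun d =>
    map_prod (ZMod.stdAddChar (N := b)).toMonoidHom
      (fun t => Multiplicative.ofAdd (d t * c t)) Finset.univ
  simp only [h1]
  have h2 := (Finset.prod_univ_sum (fun _ : ι => (Finset.univ : Finset (ZMod b)))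
    (fun t x => (ZMod.stdAddChar (x * c t) : ℂ))).symm
  rw [Fintype.piFinset_univ] at h2
  rw [h2]
  simp only [AddChar.sum_mulShift _ (ZMod.isPrimitive_stdAddChar b), ZMod.card]
  split_ifs with h
  · simp [h]
  · obtain ⟨t, ht⟩ := Function.ne_iff.1 h
    exact Finset.prod_eq_zero (Finset.mem_univ t) (by rw [if_neg (by simpa using ht), Nat.cast_zero])

theorem Sym.sum_range_zdgt {b N : ℕ} [NeZero b] (F : (Fin N → ZMod b) → ℂ) :
    ∑ n ∈ Finset.range (b ^ N), F (fun t => zdgt b n t) = ∑ d, F d := by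
  rw [← Fin.sum_univ_eq_sum_range (fun n => F (fun t => zdgt b n t)) (b ^ N)]
  let e : Fin b ≃ ZMod b :=
    { toFun := fun x => ((x : ℕ) : ZMod b)
      invFun := fun x => ⟨x.val, ZMod.val_lt x⟩
      left_inv := fun x => Fin.ext (ZMod.val_cast_of_lt x.2)
      right_inv := fun x => ZMod.natCast_zmod_val x }
  refine Fintype.sum_equiv (finFunctionFinEquiv.symm.trans (Equiv.piCongrRight fun _ => e)) _ _ ?_
  intro n
  congr 1

theorem Sym.sum_range_stdAddChar {b N : ℕ} [NeZero b] (c : Fin N → ZMod b) :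
    ∑ n ∈ Finset.range (b ^ N), (ZMod.stdAddChar (∑ t : Fin N, zdgt b n t * c t) : ℂ)
      = if c = 0 then (b : ℂ) ^ N else 0 := by
  rw [sum_range_zdgt (fun d => ZMod.stdAddChar (∑ t : Fin N, d t * c t)), sum_pi_stdAddChar]
  simp

/-- The one-dimensional Walsh-Dirichlet kernel. -/
theorem Sym.sum_range_W_mul_conj {b : ℕ} [NeZero b] (hb : 2 ≤ b) (N : ℕ) (z w : G b) :
    ∑ k ∈ Finset.range (b ^ N), W b k z * (starRingEnd ℂ) (W b k w)
      = if ∀ i < N, w i = z i then (b : ℂ) ^ N else 0 := by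
  have h : ∀ k ∈ Finset.range (b ^ N), W b k z * (starRingEnd ℂ) (W b k w)
      = ZMod.stdAddChar (∑ t : Fin N, zdgt b k t * (z t - w t)) := by
    intro k hk
    rw [W_mul_conj, W_eq_stdAddChar_s10, sum_range_zdgt_mul hb (Finset.mem_range.1 hk)]
    rfl
  rw [Finset.sum_congr rfl h, sum_range_stdAddChar]
  refine if_congr ?_ rfl rfl
  simp only [funext_iff, Pi.zero_apply, sub_eq_zero]
  exact ⟨fun h i hi => (h ⟨i, hi⟩).symm, fun h i => (h i i.2).symm⟩

theorem Sym.dsum_cast {b k : ℕ} :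
    ((dsum b k : ℕ) : ZMod b) = ∑ i ∈ Finset.range k, zdgt b k i := by
  simp [dsum, zdgt]

theorem Sym.inE_iff_s10 {b k : ℕ} : inE b k ↔ ∑ i ∈ Finset.range k, zdgt b k i = 0 := by
  rw [← dsum_cast, ZMod.natCast_eq_zero_iff, inE, Nat.dvd_iff_mod_eq_zero]

theorem Sym.sum_WS_netPt {b m s : ℕ} [NeZero b] (C : Fin s → ℕ → Fin m → ZMod b)
    (k : Fin s → ℕ) :
    ∑ n ∈ Finset.range (b ^ m), WS b s k (netPt b m s C n)
      = if inDual b m s C k then (b : ℂ) ^ m else 0 := by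
  have h : ∀ n, WS b s k (netPt b m s C n) = ZMod.stdAddChar (∑ t : Fin m, zdgt b n t *
      (∑ j, ∑ i ∈ Finset.range (k j), zdgt b (k j) i * C j i t)) := by
    intro n
    rw [WS_eq_stdAddChar_s10]
    congr 1
    simp only [netPt, Finset.mul_sum]
    rw [Finset.sum_comm]
    refine Finset.sum_congr rfl fun j _ => ?_
    rw [Finset.sum_comm]
    exact Finset.sum_congr rfl fun i _ => Finset.sum_congr rfl fun t _ => by ring
  simp only [h]
  rw [sum_range_stdAddChar]
  exact if_congr (by simp [funext_iff, inDual]) rfl rfl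

theorem Sym.sum_WS_ept {b s : ℕ} [NeZero b] (k : Fin s → ℕ) :
    ∑ l : Fin s → ZMod b, WS b s k (ept b s l)
      = if ∀ j, inE b (k j) then (b : ℂ) ^ s else 0 := by
  have h : ∀ l, WS b s k (ept b s l) = ZMod.stdAddChar (∑ j, l j *
      (∑ i ∈ Finset.range (k j), zdgt b (k j) i)) := by
    intro l
    rw [WS_eq_stdAddChar_s10]
    simp only [ept, Finset.mul_sum, mul_comm]
  simp only [h]
  rw [sum_pi_stdAddChar, Fintype.card_fin]
  exact if_congr (by simp [funext_iff, inE_iff_s10]) rfl rfl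

/-- The character sum over the symmetrized digital net. -/
theorem Sym.sum_WS_sym {b m s : ℕ} [NeZero b] (C : Fin s → ℕ → Fin m → ZMod b)
    (k : Fin s → ℕ) :
    ∑ q ∈ Finset.range (b ^ m) ×ˢ (Finset.univ : Finset (Fin s → ZMod b)),
        WS b s k (netPt b m s C q.1 + ept b s q.2)
      = if inDual b m s C k ∧ ∀ j, inE b (k j) then (b : ℂ) ^ m * (b : ℂ) ^ s else 0 := by
  simp only [WS_add]
  rw [Finset.sum_product]
  dsimp only
  rw [← Finset.sum_mul_sum, sum_WS_netPt, sum_WS_ept]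
  split_ifs <;> simp_all

/-- The digits of a point of `G`, as elements of `Fin b`. -/
def Sym.finDigits {b : ℕ} [NeZero b] (z : G b) : ℕ → Fin b :=
  fun i => ⟨(z i).val, ZMod.val_lt _⟩

theorem Sym.projG_eq_ofDigits {b : ℕ} [NeZero b] (z : G b) :
    projG b z = Real.ofDigits (finDigits z) := by
  simp [projG, Real.ofDigits, Real.ofDigitsTerm, finDigits, div_eq_mul_inv]

theorem Sym.projS_mem_cube {b s : ℕ} [NeZero b] (z : Fin s → G b) : projS b s z ∈ cube s := by
  refine ⟨fun j => ?_, fun j => ?_⟩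
  · simpa [projS, projG_eq_ofDigits] using Real.ofDigits_nonneg _
  · simpa [projS, projG_eq_ofDigits] using Real.ofDigits_le_one _

theorem Sym.abs_projG_sub_le {b N : ℕ} [NeZero b] {z w : G b} (h : ∀ i < N, z i = w i) :
    |projG b z - projG b w| ≤ ((b : ℝ) ^ N)⁻¹ := by
  rw [projG_eq_ofDigits, projG_eq_ofDigits]
  exact Real.abs_ofDigits_sub_ofDigits_le fun i hi => by simp [finDigits, h i hi]

theorem Sym.projG_secG {b : ℕ} [NeZero b] (hb : 2 ≤ b) {x : ℝ} (hx : x ∈ Set.Icc (0 : ℝ) 1) :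
    projG b (secG b x) = x := by
  rw [projG_eq_ofDigits]
  by_cases h1 : x = 1
  · have h : finDigits (secG b x) = fun _ => (⟨b - 1, by omega⟩ : Fin b) := by
      funext i
      obtain ⟨c, rfl⟩ : ∃ c, b = c + 1 := ⟨b - 1, by omega⟩
      simp [finDigits, secG, h1, ZMod.val_neg_one]
    rw [h, Real.ofDigits_const_last_eq_one' (by omega), h1]
  · have hx' : x ∈ Set.Ico (0 : ℝ) 1 := ⟨hx.1, lt_of_le_of_ne hx.2 h1⟩
    conv_rhs => rw [← Real.ofDigits_digits (b := b) (by omega) hx']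
    congr 1
    funext i
    have h0 : (0 : ℝ) ≤ x * (b : ℝ) ^ (i + 1) := mul_nonneg hx.1 (by positivity)
    refine Fin.ext ?_
    simp only [finDigits, secG, if_neg h1, Real.digits, Fin.val_ofNat]
    rw [← Int.natCast_floor_eq_floor h0, Int.cast_natCast, ZMod.val_natCast]

theorem Sym.exists_floor_iff {b : ℕ} [NeZero b] (z : G b) (N : ℕ) :
    ∃ a : ℤ, 0 ≤ a ∧ a + 1 ≤ (b : ℤ) ^ N ∧ ∀ x ∈ Set.Ico (0 : ℝ) 1,
      (∀ i < N, secG b x i = z i) ↔ ⌊x * (b : ℝ) ^ N⌋ = a := by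
  have hb0 : (0 : ℤ) < b := by exact_mod_cast Nat.pos_of_ne_zero (NeZero.ne b)
  induction N with
  | zero =>
    refine ⟨0, le_rfl, by simp, fun x hx => ?_⟩
    simp [Int.floor_eq_zero_iff.2 hx]
  | succ N ih =>
    obtain ⟨a, ha0, ha1, ha⟩ := ih
    have hv : ((z N).val : ℤ) < b := by exact_mod_cast ZMod.val_lt (z N)
    have hv0 : (0 : ℤ) ≤ ((z N).val : ℤ) := Int.natCast_nonneg _
    refine ⟨(z N).val + b * a, by positivity, ?_, fun x hx => ?_⟩
    · rw [pow_succ']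
      nlinarith
    · have hsec : secG b x N = ((⌊x * (b : ℝ) ^ (N + 1)⌋ : ℤ) : ZMod b) := by
        simp [secG, hx.2.ne]
      have hdiv : ⌊x * (b : ℝ) ^ N⌋ = ⌊x * (b : ℝ) ^ (N + 1)⌋ / (b : ℤ) := by
        rw [← Int.floor_div_natCast]
        congr 1
        have : (b : ℝ) ≠ 0 := NeZero.ne _
        rw [pow_succ]
        field_simp
      have hmod : secG b x N = z N ↔ ⌊x * (b : ℝ) ^ (N + 1)⌋ % (b : ℤ) = (z N).val := by
        rw [hsec]
        conv_lhs => rw [← ZMod.natCast_zmod_val (z N), ← Int.cast_natCast (R := ZMod b)]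
        rw [ZMod.intCast_eq_intCast_iff', Int.emod_eq_of_lt hv0 hv]
      rw [Nat.forall_lt_succ_right, ha x hx, hmod, hdiv, Int.ediv_emod_unique hb0]
      constructor
      · rintro ⟨h, -⟩
        exact h.symm
      · intro h
        exact ⟨h.symm, hv0, hv⟩

/-- The Walsh-Dirichlet kernel of order `b ^ N`, centred at `z`. -/
def Sym.walshKernel (b N : ℕ) (z : G b) (x : ℝ) : ℝ :=
  if ∀ i < N, secG b x i = z i then (b : ℝ) ^ N else 0

theorem Sym.walshKernel_nonneg {b N : ℕ} {z : G b} {x : ℝ} : 0 ≤ walshKernel b N z x := by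
  unfold walshKernel
  split_ifs <;> positivity

theorem Sym.integral_walshKernel {b : ℕ} [NeZero b] (N : ℕ) (z : G b) :
    ∫ x in Set.Icc (0 : ℝ) 1, walshKernel b N z x = 1 := by
  obtain ⟨a, ha0, ha1, ha⟩ := exists_floor_iff z N
  have hbN : (0 : ℝ) < (b : ℝ) ^ N := by
    have : (0 : ℝ) < b := by exact_mod_cast Nat.pos_of_ne_zero (NeZero.ne b)
    positivity
  have ha0' : (0 : ℝ) ≤ a := by exact_mod_cast ha0
  have ha1' : (a : ℝ) + 1 ≤ (b : ℝ) ^ N := by exact_mod_cast ha1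
  set S : Set ℝ := Set.Ico (a / (b : ℝ) ^ N) ((a + 1) / (b : ℝ) ^ N) with hS
  have hSsub : S ⊆ Set.Ico 0 1 := by
    rintro x ⟨h1, h2⟩
    exact ⟨(by positivity : (0 : ℝ) ≤ a / (b : ℝ) ^ N).trans h1,
      h2.trans_le ((div_le_one hbN).2 ha1')⟩
  rw [← restrict_Ico_eq_restrict_Icc,
    setIntegral_congr_fun (g := S.indicator fun _ => (b : ℝ) ^ N) measurableSet_Ico,
    setIntegral_indicator measurableSet_Ico, ← hS, Set.inter_eq_right.2 hSsub, setIntegral_const, hS,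
    Real.volume_real_Ico, ← sub_div, add_sub_cancel_left, max_eq_left (by positivity), smul_eq_mul,
    one_div_mul_cancel hbN.ne']
  intro x hx
  simp only [walshKernel, Set.indicator]
  refine if_congr ?_ rfl rfl
  rw [ha x hx, Int.floor_eq_iff, hS, Set.mem_Ico, div_le_iff₀ hbN, lt_div_iff₀ hbN]

theorem Sym.volume_restrict_cube (s : ℕ) :
    (volume : Measure (Fin s → ℝ)).restrict (cube s)
      = Measure.pi fun _ => (volume : Measure ℝ).restrict (Set.Icc 0 1) := by
  rw [← Measure.restrict_pi_pi, Set.pi_univ_Icc]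
  rfl

/-- The multivariate Walsh-Dirichlet kernel. -/
def Sym.walshKernelS (b s N : ℕ) (z : Fin s → G b) (x : Fin s → ℝ) : ℝ :=
  ∏ j, walshKernel b N (z j) (x j)

theorem Sym.walshKernelS_nonneg {b s N : ℕ} {z : Fin s → G b} {x : Fin s → ℝ} :
    0 ≤ walshKernelS b s N z x :=
  Finset.prod_nonneg fun _ _ => walshKernel_nonneg

theorem Sym.integral_walshKernelS {b s : ℕ} [NeZero b] (N : ℕ) (z : Fin s → G b) :
    ∫ x in cube s, walshKernelS b s N z x = 1 := by
  simp only [walshKernelS]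
  rw [volume_restrict_cube, integral_fintype_prod_eq_prod (fun j => walshKernel b N (z j))]
  simp [integral_walshKernel]

theorem Sym.integrable_walshKernelS {b s : ℕ} [NeZero b] (N : ℕ) (z : Fin s → G b) :
    IntegrableOn (walshKernelS b s N z) (cube s) := by
  by_contra h
  exact zero_ne_one ((integral_undef h).symm.trans (integral_walshKernelS N z))

theorem Sym.dist_projS_le {b s N : ℕ} [NeZero b] (hb : 2 ≤ b) {z : Fin s → G b}
    {x : Fin s → ℝ} (hx : x ∈ cube s) (h : walshKernelS b s N z x ≠ 0) :
    dist x (projS b s z) ≤ ((b : ℝ) ^ N)⁻¹ := by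
  rw [dist_pi_le_iff (by positivity)]
  intro j
  have hj : walshKernel b N (z j) (x j) ≠ 0 := Finset.prod_ne_zero_iff.1 h j (Finset.mem_univ j)
  have hj' : ∀ i < N, secG b (x j) i = z j i := by
    by_contra hc
    exact hj (if_neg hc)
  have := abs_projG_sub_le hj'
  rwa [projG_secG hb ⟨hx.1 j, hx.2 j⟩] at this

theorem Sym.sum_WS_mul_conj_walS {b s : ℕ} [NeZero b] (hb : 2 ≤ b) (N : ℕ) (z : Fin s → G b)
    (x : Fin s → ℝ) :
    ∑ k ∈ Fintype.piFinset (fun _ : Fin s => Finset.range (b ^ N)),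
        (starRingEnd ℂ) (walS b s k x) * WS b s k z = (walshKernelS b s N z x : ℂ) := by
  have h : ∀ k, (starRingEnd ℂ) (walS b s k x) * WS b s k z
      = ∏ j, W b (k j) (z j) * (starRingEnd ℂ) (W b (k j) (secG b (x j))) := by
    intro k
    rw [Finset.prod_mul_distrib, mul_comm, walS, WS, WS, map_prod]
    rfl
  simp only [h]
  rw [← Finset.prod_univ_sum (fun _ : Fin s => Finset.range (b ^ N))
    (fun j k => W b k (z j) * (starRingEnd ℂ) (W b k (secG b (x j))))]
  simp only [sum_range_W_mul_conj hb, walshKernelS, walshKernel]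
  push_cast [apply_ite]
  rfl

theorem Sym.norm_walS {b s : ℕ} [NeZero b] (k : Fin s → ℕ) (x : Fin s → ℝ) :
    ‖walS b s k x‖ = 1 := norm_WS _ _

theorem Sym.measurable_walS {b s : ℕ} (k : Fin s → ℕ) : Measurable (walS b s k) := by
  have hsec : ∀ i, Measurable fun x : ℝ => ((secG b x i).val : ℝ) := by
    intro i
    have h : Measurable fun x : ℝ => secG b x i := by
      refine Measurable.ite (measurableSet_singleton 1) measurable_const ?_
      exact (measurable_from_top (f := fun n : ℤ => (n : ZMod b))).comp
        (Int.measurable_floor.comp (measurable_id.mul_const _))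
    exact (measurable_from_top (f := fun n : ZMod b => (n.val : ℝ))).comp h
  have hW : ∀ n, Measurable fun x : ℝ => W b n (secG b x) := by
    intro n
    unfold W
    have : Measurable fun x : ℝ =>
        ∑ i ∈ Finset.range n, (dgt b n i : ℝ) * ((secG b x i).val : ℝ) :=
      Finset.measurable_sum _ fun i _ => (hsec i).const_mul _
    fun_prop
  unfold walS WS
  exact Finset.measurable_prod _ fun j _ => (hW (k j)).comp (measurable_pi_apply j)

theorem Sym.isCompact_cube (s : ℕ) : IsCompact (cube s) := isCompact_Icc

theorem Sym.measurableSet_cube (s : ℕ) : MeasurableSet (cube s) := measurableSet_Icc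

theorem Sym.integrableOn_mul_conj_walS {b s : ℕ} [NeZero b] {f : (Fin s → ℝ) → ℂ}
    (hf : ContinuousOn f (cube s)) (k : Fin s → ℕ) :
    IntegrableOn (fun x => f x * (starRingEnd ℂ) (walS b s k x)) (cube s) := by
  refine (hf.integrableOn_compact (isCompact_cube s)).mul_bdd (c := 1) ?_ ?_
  · exact (Complex.continuous_conj.measurable.comp (measurable_walS k)).aestronglyMeasurable
  · exact Filter.Eventually.of_forall fun x => by simp [norm_walS]

/-- A continuous function on the unit cube with summable Walsh coefficients is represented by its
Walsh series, in the sense that the character series on `G ^ s` sums to `f ∘ π`. -/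
theorem Sym.hasSum_walsh {b s : ℕ} [NeZero b] (hb : 2 ≤ b) {f : (Fin s → ℝ) → ℂ}
    (hf : ContinuousOn f (cube s)) (z : Fin s → G b)
    (hs : Summable fun k => ‖∫ x in cube s, f x * (starRingEnd ℂ) (walS b s k x)‖) :
    HasSum (fun k => (∫ x in cube s, f x * (starRingEnd ℂ) (walS b s k x)) * WS b s k z)
      (f (projS b s z)) := by
  have hsum : Summable fun k =>
      (∫ x in cube s, f x * (starRingEnd ℂ) (walS b s k x)) * WS b s k z :=
    Summable.of_norm (by simpa [norm_WS] using hs)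
  have hbox : Filter.Tendsto
      (fun N : ℕ => Fintype.piFinset fun _ : Fin s => Finset.range (b ^ N))
      Filter.atTop Filter.atTop := by
    refine Filter.tendsto_atTop_finset_of_monotone (fun N M h => ?_) fun k => ?_
    · exact Fintype.piFinset_subset _ _ fun _ =>
        Finset.range_mono (Nat.pow_le_pow_right (by omega) h)
    · refine ⟨∑ j, k j, Fintype.mem_piFinset.2 fun j => Finset.mem_range.2 ?_⟩
      exact (Finset.single_le_sum (fun _ _ => Nat.zero_le _) (Finset.mem_univ j)).trans_lt
        (Nat.lt_pow_self (by omega))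
  have hpart : ∀ N : ℕ, ∑ k ∈ Fintype.piFinset (fun _ : Fin s => Finset.range (b ^ N)),
      (∫ x in cube s, f x * (starRingEnd ℂ) (walS b s k x)) * WS b s k z
        = ∫ x in cube s, f x * (walshKernelS b s N z x : ℂ) := by
    intro N
    simp only [← sum_WS_mul_conj_walS hb, Finset.mul_sum, ← mul_assoc]
    rw [integral_finsetSum _ fun k _ => (integrableOn_mul_conj_walS hf k).mul_const _]
    exact Finset.sum_congr rfl fun k _ => (integral_mul_const _ _).symm
  have hint : ∀ N : ℕ, IntegrableOn (fun x => f x * (walshKernelS b s N z x : ℂ)) (cube s) := by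
    intro N
    simp only [← sum_WS_mul_conj_walS hb, Finset.mul_sum, ← mul_assoc]
    exact integrable_finsetSum _ fun k _ => (integrableOn_mul_conj_walS hf k).mul_const _
  have hconv : Filter.Tendsto (fun N : ℕ =>
      ∑ k ∈ Fintype.piFinset (fun _ : Fin s => Finset.range (b ^ N)),
        (∫ x in cube s, f x * (starRingEnd ℂ) (walS b s k x)) * WS b s k z)
      Filter.atTop (nhds (f (projS b s z))) := by
    simp only [hpart]
    rw [Metric.tendsto_atTop]
    intro ε hε
    obtain ⟨δ, hδ, hfδ⟩ := Metric.continuousOn_iff.1 hf _ (projS_mem_cube z) (ε / 2) (half_pos hε)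
    have hlim : Filter.Tendsto (fun N : ℕ => ((b : ℝ) ^ N)⁻¹) Filter.atTop (nhds 0) :=
      tendsto_inv_atTop_zero.comp
        (tendsto_pow_atTop_atTop_of_one_lt (by exact_mod_cast (by omega : 1 < b)))
    obtain ⟨N₀, hN₀⟩ := Filter.eventually_atTop.1 (hlim.eventually (gt_mem_nhds hδ))
    refine ⟨N₀, fun N hN => ?_⟩
    have hcast : IntegrableOn (fun x => (walshKernelS b s N z x : ℂ)) (cube s) :=
      (integrable_walshKernelS N z).ofReal
    have hconst : f (projS b s z)
        = ∫ x in cube s, f (projS b s z) * (walshKernelS b s N z x : ℂ) := by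
      rw [integral_const_mul, integral_complex_ofReal, integral_walshKernelS]
      simp
    rw [dist_eq_norm, hconst, ← integral_sub (hint N) (hcast.const_mul _)]
    have hbound := norm_integral_le_of_norm_le
      (f := fun x => f x * (walshKernelS b s N z x : ℂ)
        - f (projS b s z) * (walshKernelS b s N z x : ℂ))
      ((integrable_walshKernelS N z).const_mul (ε / 2))
      ((ae_restrict_iff' (measurableSet_cube s)).2 (Filter.Eventually.of_forall fun x hx => ?_))
    · rw [integral_const_mul, integral_walshKernelS, mul_one] at hbound
      linarith
    · rw [← sub_mul, norm_mul, Complex.norm_real, Real.norm_of_nonneg walshKernelS_nonneg]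
      by_cases h0 : walshKernelS b s N z x = 0
      · simp [h0]
      · refine mul_le_mul_of_nonneg_right ?_ walshKernelS_nonneg
        rw [← dist_eq_norm]
        exact (hfδ x hx ((dist_projS_le hb hx h0).trans_lt (hN₀ N hN))).le
  have := tendsto_nhds_unique (hsum.hasSum.comp hbox) hconv
  rw [← this]
  exact hsum.hasSum

theorem Sym.sum_map_symNetPts {b m s : ℕ} [NeZero b] (C : Fin s → ℕ → Fin m → ZMod b)
    (f : (Fin s → ℝ) → ℝ) :
    ((symNetPts b m s C).map f).sum
      = ∑ q ∈ Finset.range (b ^ m) ×ˢ (Finset.univ : Finset (Fin s → ZMod b)),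
          f (projS b s (netPt b m s C q.1 + ept b s q.2)) := by
  rw [Finset.sum_product]
  simp only [symNetPts, symMS, netMS, Multiset.map_bind, Multiset.sum_bind, Multiset.map_map]
  rfl

theorem Sym.card_symNetPts {b m s : ℕ} [NeZero b] (C : Fin s → ℕ → Fin m → ZMod b) :
    (symNetPts b m s C).card = b ^ m * b ^ s := by
  simp [symNetPts, symMS, netMS, Multiset.card_bind]

theorem HasSum.prod_fiberwise_snd {β γ : Type*} {f : β × γ → ℂ} {g : γ → ℂ} {a : ℂ}
    (hf : HasSum f a) (hg : ∀ c, HasSum (fun b => f (b, c)) (g c)) : HasSum g a :=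
  ((Equiv.prodComm γ β).hasSum_iff.2 hf).prod_fiberwise hg

section Kernel

variable {b s : ℕ} {K : (Fin s → ℝ) → (Fin s → ℝ) → ℝ}

/-- The Walsh coefficient, with respect to the second variable, of a kernel. -/
def Sym.walshSlice (b s : ℕ) (K : (Fin s → ℝ) → (Fin s → ℝ) → ℝ) (l : Fin s → ℕ)
    (x : Fin s → ℝ) : ℂ :=
  ∫ y in cube s, (K x y : ℂ) * walS b s l y

theorem Sym.Khat_eq_integral_walshSlice (k l : Fin s → ℕ) :
    Khat b s K k l
      = ∫ x in cube s, walshSlice b s K l x * (starRingEnd ℂ) (walS b s k x) := by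
  simp only [Khat, walshSlice, ← integral_mul_const]
  simp only [mul_right_comm]

theorem Sym.continuousOn_slice
    (hK : ContinuousOn (fun p : (Fin s → ℝ) × (Fin s → ℝ) => K p.1 p.2) (cube s ×ˢ cube s))
    {x : Fin s → ℝ} (hx : x ∈ cube s) : ContinuousOn (fun y => (K x y : ℂ)) (cube s) :=
  Complex.continuous_ofReal.comp_continuousOn
    (hK.comp (f := fun y => (x, y)) (by fun_prop) fun _ hy => ⟨hx, hy⟩)

theorem Sym.continuousOn_walshSlice [NeZero b]
    (hK : ContinuousOn (fun p : (Fin s → ℝ) × (Fin s → ℝ) => K p.1 p.2) (cube s ×ˢ cube s))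
    (l : Fin s → ℕ) : ContinuousOn (walshSlice b s K l) (cube s) := by
  obtain ⟨M, hM⟩ := ((isCompact_cube s).prod (isCompact_cube s)).exists_bound_of_continuousOn hK
  have hfin : IsFiniteMeasure ((volume : Measure (Fin s → ℝ)).restrict (cube s)) :=
    ⟨by simpa using (isCompact_cube s).measure_lt_top⟩
  refine continuousOn_of_dominated (bound := fun _ => M) (fun x hx => ?_) (fun x hx => ?_)
    (integrable_const M) ?_
  · exact ((continuousOn_slice hK hx).aestronglyMeasurable (measurableSet_cube s)).mul
      (measurable_walS l).aestronglyMeasurable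
  · refine (ae_restrict_iff' (measurableSet_cube s)).2 (Filter.Eventually.of_forall fun y hy => ?_)
    rw [norm_mul, norm_walS, mul_one, Complex.norm_real]
    exact hM (x, y) ⟨hx, hy⟩
  · refine (ae_restrict_iff' (measurableSet_cube s)).2 (Filter.Eventually.of_forall fun y hy => ?_)
    refine ContinuousOn.mul ?_ continuousOn_const
    exact Complex.continuous_ofReal.comp_continuousOn
      (hK.comp (f := fun x => (x, y)) (by fun_prop) fun _ hx => ⟨hx, hy⟩)

theorem Sym.hasSum_walshSlice [NeZero b] (hb : 2 ≤ b)
    (hK : ContinuousOn (fun p : (Fin s → ℝ) × (Fin s → ℝ) => K p.1 p.2) (cube s ×ˢ cube s))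
    (hs : Summable fun kl : (Fin s → ℕ) × (Fin s → ℕ) => ‖Khat b s K kl.1 kl.2‖)
    (l : Fin s → ℕ) (z : Fin s → G b) :
    HasSum (fun k => Khat b s K k l * WS b s k z) (walshSlice b s K l (projS b s z)) := by
  have hl : Summable fun k => ‖Khat b s K k l‖ :=
    hs.comp_injective (i := fun k => (k, l)) fun _ _ h => congrArg Prod.fst h
  simp only [Khat_eq_integral_walshSlice] at hl ⊢
  exact hasSum_walsh hb (continuousOn_walshSlice hK l) z hl

/-- The Walsh series of the kernel on `G ^ s × G ^ s` represents `K ∘ (π × π)`. -/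
theorem Sym.hasSum_Khat [NeZero b] (hb : 2 ≤ b)
    (hK : ContinuousOn (fun p : (Fin s → ℝ) × (Fin s → ℝ) => K p.1 p.2) (cube s ×ˢ cube s))
    (hs : Summable fun kl : (Fin s → ℕ) × (Fin s → ℕ) => ‖Khat b s K kl.1 kl.2‖)
    (z w : Fin s → G b) :
    HasSum (fun kl : (Fin s → ℕ) × (Fin s → ℕ) =>
        Khat b s K kl.1 kl.2 * WS b s kl.1 z * (starRingEnd ℂ) (WS b s kl.2 w))
      (K (projS b s z) (projS b s w) : ℂ) := by
  have hsum : Summable fun kl : (Fin s → ℕ) × (Fin s → ℕ) =>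
      Khat b s K kl.1 kl.2 * WS b s kl.1 z * (starRingEnd ℂ) (WS b s kl.2 w) :=
    Summable.of_norm (by simpa [norm_WS] using hs)
  obtain ⟨S, hS⟩ := hsum
  have hcol : ∀ l, HasSum
      (fun k => Khat b s K k l * WS b s k z * (starRingEnd ℂ) (WS b s l w))
      (walshSlice b s K l (projS b s z) * (starRingEnd ℂ) (WS b s l w)) :=
    fun l => (hasSum_walshSlice hb hK hs l z).mul_right _
  have hfib : HasSum
      (fun l => walshSlice b s K l (projS b s z) * (starRingEnd ℂ) (WS b s l w)) S :=
    hS.prod_fiberwise_snd hcol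
  have hconj : ∀ l, ∫ y in cube s, (K (projS b s z) y : ℂ) * (starRingEnd ℂ) (walS b s l y)
      = (starRingEnd ℂ) (walshSlice b s K l (projS b s z)) := by
    intro l
    rw [walshSlice, ← integral_conj]
    simp only [map_mul, Complex.conj_ofReal]
  have hrow := hasSum_walsh hb (continuousOn_slice hK (projS_mem_cube z)) w <| by
    refine hfib.summable.norm.congr fun l => ?_
    rw [hconj, norm_mul, RCLike.norm_conj, RCLike.norm_conj, norm_WS, mul_one]
  have hrow' : HasSum
      (fun l => walshSlice b s K l (projS b s z) * (starRingEnd ℂ) (WS b s l w))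
      (K (projS b s z) (projS b s w) : ℂ) := by
    rw [← Complex.hasSum_conj', Complex.conj_ofReal]
    refine hrow.congr_fun fun l => ?_
    rw [hconj, map_mul, Complex.conj_conj]
  rwa [hrow'.unique hfib]

end Kernel

theorem Sym.inDual_zero {b m s : ℕ} (C : Fin s → ℕ → Fin m → ZMod b) :
    inDual b m s C 0 := by
  simp [inDual]

theorem Sym.inE_zero {b : ℕ} : inE b 0 := by simp [inE, dsum]

theorem Sym.walshSlice_zero {b s : ℕ} (K : (Fin s → ℝ) → (Fin s → ℝ) → ℝ) (x : Fin s → ℝ) :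
    walshSlice b s K 0 x = ((∫ y in cube s, K x y : ℝ) : ℂ) := by
  simp only [walshSlice, walS, WS_zero, mul_one]
  exact integral_complex_ofReal

theorem Sym.Khat_zero_zero {b s : ℕ} (K : (Fin s → ℝ) → (Fin s → ℝ) → ℝ) :
    Khat b s K 0 0 = ((∫ x in cube s, ∫ y in cube s, K x y : ℝ) : ℂ) := by
  rw [Khat_eq_integral_walshSlice]
  simp only [walshSlice_zero, walS, WS_zero, map_one, mul_one]
  exact integral_complex_ofReal

theorem Sym.Khat_zero_left {b s : ℕ} [NeZero b] {K : (Fin s → ℝ) → (Fin s → ℝ) → ℝ}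
    (hK : ContinuousOn (fun p : (Fin s → ℝ) × (Fin s → ℝ) => K p.1 p.2) (cube s ×ˢ cube s))
    (hsymm : ∀ x y, K x y = K y x) (l : Fin s → ℕ) :
    Khat b s K 0 l = (starRingEnd ℂ) (Khat b s K l 0) := by
  have hint : Integrable (fun p : (Fin s → ℝ) × (Fin s → ℝ) => (K p.1 p.2 : ℂ) * walS b s l p.2)
      ((volume.restrict (cube s)).prod (volume.restrict (cube s))) := by
    refine Integrable.mul_bdd (c := 1) ?_
      ((measurable_walS l).comp measurable_snd).aestronglyMeasurable
      (Filter.Eventually.of_forall fun p => (norm_walS l p.2).le)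
    rw [Measure.prod_restrict]
    exact (Complex.continuous_ofReal.comp_continuousOn hK).integrableOn_compact
      ((isCompact_cube s).prod (isCompact_cube s))
  have h0 : Khat b s K 0 l = ∫ x in cube s, ∫ y in cube s, (K x y : ℂ) * walS b s l y := by
    simp only [Khat, walS, WS_zero, map_one, mul_one]
  have h1 : Khat b s K l 0
      = ∫ x in cube s, ∫ y in cube s, (K x y : ℂ) * (starRingEnd ℂ) (walS b s l x) := by
    simp only [Khat]
    simp only [walS, WS_zero, mul_one]
  rw [h0, h1, ← integral_conj, integral_integral_swap hint]
  simp only [← integral_conj, map_mul, Complex.conj_ofReal, Complex.conj_conj]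
  refine integral_congr_ae (Filter.Eventually.of_forall fun y => ?_)
  simp only [hsymm]

-- STATEMENT 10
theorem stmt10 (b : ℕ) (hb : 2 ≤ b) [NeZero b] (m s : ℕ) (hm : 1 ≤ m) (hs : 1 ≤ s)
    (C : Fin s → ℕ → Fin m → ZMod b)
    (K : (Fin s → ℝ) → (Fin s → ℝ) → ℝ)
    (hKcont : ContinuousOn (fun p : (Fin s → ℝ) × (Fin s → ℝ) => K p.1 p.2)
      (cube s ×ˢ cube s))
    (hKsymm : ∀ x y, K x y = K y x)
    (hKsum : Summable fun kl : (Fin s → ℕ) × (Fin s → ℕ) => ‖Khat b s K kl.1 kl.2‖) :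
    (sqErr s (symNetPts b m s C) K : ℂ)
      = ∑' kl : (Fin s → ℕ) × (Fin s → ℕ),
          if inDual b m s C kl.1 ∧ (∀ j, inE b (kl.1 j)) ∧ kl.1 ≠ 0
              ∧ inDual b m s C kl.2 ∧ (∀ j, inE b (kl.2 j)) ∧ kl.2 ≠ 0
          then Khat b s K kl.1 kl.2 else 0 := by
  set Q : Finset (ℕ × (Fin s → ZMod b)) := Finset.range (b ^ m) ×ˢ Finset.univ
  set p : ℕ × (Fin s → ZMod b) → Fin s → G b := fun q => netPt b m s C q.1 + ept b s q.2
  set M : ℂ := (b : ℂ) ^ m * (b : ℂ) ^ s with hM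
  have hM0 : M ≠ 0 := by
    have : (b : ℂ) ≠ 0 := NeZero.ne _
    simp [hM, this]
  have hMconj : (starRingEnd ℂ) M = M := by simp [hM]
  let D : (Fin s → ℕ) → Prop := fun k => inDual b m s C k ∧ ∀ j, inE b (k j)
  have hD0 : D 0 := ⟨inDual_zero C, fun _ => inE_zero⟩
  have hchar : ∀ k, ∑ q ∈ Q, WS b s k (p q) = if D k then M else 0 := sum_WS_sym C
  have hdouble : HasSum (fun kl : (Fin s → ℕ) × (Fin s → ℕ) =>
      if D kl.1 ∧ D kl.2 then Khat b s K kl.1 kl.2 else 0)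
      (1 / M ^ 2 * ∑ q ∈ Q, ∑ q' ∈ Q, (K (projS b s (p q)) (projS b s (p q')) : ℂ)) := by
    have h := (hasSum_sum fun q _ => hasSum_sum fun q' _ =>
      hasSum_Khat hb hKcont hKsum (p q) (p q') : HasSum (fun kl => ∑ q ∈ Q, ∑ q' ∈ Q, _) _)
    refine (h.mul_left (1 / M ^ 2)).congr_fun fun kl => ?_
    simp only [mul_assoc, ← Finset.mul_sum]
    rw [← Finset.sum_mul, ← map_sum, hchar, hchar]
    by_cases h1 : D kl.1
    · by_cases h2 : D kl.2
      · rw [if_pos ⟨h1, h2⟩, if_pos h1, if_pos h2, hMconj]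
        field_simp
      · simp [h2]
    · simp [h1]
  have hsingle : HasSum (fun k => if D k then Khat b s K k 0 else 0)
      (1 / M * ∑ q ∈ Q, ((∫ y in cube s, K (projS b s (p q)) y : ℝ) : ℂ)) := by
    have h := (hasSum_sum fun q _ => hasSum_walshSlice hb hKcont hKsum 0 (p q) :
      HasSum (fun k => ∑ q ∈ Q, _) _)
    simp only [walshSlice_zero] at h
    refine (h.mul_left (1 / M)).congr_fun fun k => ?_
    rw [← Finset.mul_sum, hchar]
    split_ifs
    · field_simp
    · simp
  have hcol : HasSum (fun kl : (Fin s → ℕ) × (Fin s → ℕ) =>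
      if D kl.1 ∧ kl.2 = 0 then Khat b s K kl.1 kl.2 else 0)
      (1 / M * ∑ q ∈ Q, ((∫ y in cube s, K (projS b s (p q)) y : ℝ) : ℂ)) := by
    have hinj : Function.Injective fun k : Fin s → ℕ => (k, (0 : Fin s → ℕ)) :=
      fun _ _ h => congrArg Prod.fst h
    refine (hinj.hasSum_iff ?_).1 (hsingle.congr_fun fun k => ?_)
    · rintro ⟨k, l⟩ hkl
      refine if_neg fun h => hkl ⟨k, ?_⟩
      rw [← h.2]
    · simp
  have hrow : HasSum (fun kl : (Fin s → ℕ) × (Fin s → ℕ) =>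
      if kl.1 = 0 ∧ D kl.2 then Khat b s K kl.1 kl.2 else 0)
      (1 / M * ∑ q ∈ Q, ((∫ y in cube s, K (projS b s (p q)) y : ℝ) : ℂ)) := by
    have hinj : Function.Injective fun l : Fin s → ℕ => ((0 : Fin s → ℕ), l) :=
      fun _ _ h => congrArg Prod.snd h
    refine (hinj.hasSum_iff ?_).1 ?_
    · rintro ⟨k, l⟩ hkl
      refine if_neg fun h => hkl ⟨l, ?_⟩
      rw [← h.1]
    · rw [← Complex.hasSum_conj', map_mul, map_div₀, map_one, hMconj, map_sum]
      simp only [Complex.conj_ofReal]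
      refine hsingle.congr_fun fun l => ?_
      simp only [Function.comp_apply, true_and, Khat_zero_left hKcont hKsymm]
      split_ifs <;> simp
  have hzero : HasSum (fun kl : (Fin s → ℕ) × (Fin s → ℕ) =>
      if kl.1 = 0 ∧ kl.2 = 0 then Khat b s K kl.1 kl.2 else 0)
      ((∫ x in cube s, ∫ y in cube s, K x y : ℝ) : ℂ) := by
    rw [← Khat_zero_zero (b := b)]
    refine (hasSum_ite_eq ((0, 0) : (Fin s → ℕ) × (Fin s → ℕ)) (Khat b s K 0 0)).congr_fun
      fun kl => ?_
    rcases kl with ⟨k, l⟩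
    simp only [Prod.mk.injEq]
    split_ifs with h
    · rw [h.1, h.2]
    · rfl
  have htotal := ((hdouble.sub hcol).sub hrow).add hzero
  symm
  convert! (htotal.congr_fun fun kl => ?_).tsum_eq using 1
  · simp only [sqErr, sum_map_symNetPts, card_symNetPts]
    push_cast
    rw [← hM]
    ring
  · have hiff : (inDual b m s C kl.1 ∧ (∀ j, inE b (kl.1 j)) ∧ kl.1 ≠ 0
        ∧ inDual b m s C kl.2 ∧ (∀ j, inE b (kl.2 j)) ∧ kl.2 ≠ 0)
        ↔ (D kl.1 ∧ kl.1 ≠ 0) ∧ (D kl.2 ∧ kl.2 ≠ 0) := by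
      simp only [D, and_assoc]
    rw [if_congr hiff rfl rfl]
    by_cases h1 : kl.1 = 0 <;> by_cases h2 : kl.2 = 0 <;> by_cases h3 : D kl.1 <;>
      by_cases h4 : D kl.2 <;> simp_all

end
end
end

section
/- Let b be a prime. For every p with 1 ≤ p < ∞ there exists a constant C_p > 0 such that for every m ∈ ℕ, the two-dimensional symmetrized Hammersley point set P_H^sym in base b, consisting of N = b^{m+2} points, satisfies L_p(P_H^sym) ≤ C_p · √(m+2) / b^{m+2} = C_p · √(log_b N) / N; i.e., its L_p discrepancy is of the best possible order for all 1 ≤ p < ∞. -/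
open MeasureTheory

noncomputable section

open MeasureTheory Sym

open scoped Classical

noncomputable section

namespace Sym

/-- The two-dimensional symmetrized Hammersley point set in base `b` with `b^{m+2}`
points `(x_a, y_a)`, `a = (a₁,…,a_{m+2}) ∈ {0,…,b-1}^{m+2}`. -/
def hamSymPts (b m : ℕ) [NeZero b] : Multiset (ℝ × ℝ) :=
  (Finset.univ : Finset (Fin (m + 2) → ZMod b)).val.map fun a =>
    (∑ i : Fin m,
        ((a (Fin.castLE (by omega) i) + a ⟨m, by omega⟩).val : ℝ) / (b : ℝ) ^ ((i : ℕ) + 1)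
       + ((a ⟨m, by omega⟩).val : ℝ) / ((b : ℝ) ^ m * ((b : ℝ) - 1)),
     ∑ i : Fin m,
        ((a ⟨m - 1 - (i : ℕ), by omega⟩ + a ⟨m + 1, by omega⟩).val : ℝ) / (b : ℝ) ^ ((i : ℕ) + 1)
       + ((a ⟨m + 1, by omega⟩).val : ℝ) / ((b : ℝ) ^ m * ((b : ℝ) - 1)))

/-- The truncated two-dimensional symmetrized Hammersley point set `P_H^{sym,n}`. -/
def hamSymPtsTrunc (b m n : ℕ) [NeZero b] : Multiset (ℝ × ℝ) :=
  (Finset.univ : Finset (Fin (m + 2) → ZMod b)).val.map fun a =>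
    (∑ i : Fin m,
        ((a (Fin.castLE (by omega) i) + a ⟨m, by omega⟩).val : ℝ) / (b : ℝ) ^ ((i : ℕ) + 1)
       + ∑ i ∈ Finset.Icc (m + 1) n, ((a ⟨m, by omega⟩).val : ℝ) / (b : ℝ) ^ i,
     ∑ i : Fin m,
        ((a ⟨m - 1 - (i : ℕ), by omega⟩ + a ⟨m + 1, by omega⟩).val : ℝ) / (b : ℝ) ^ ((i : ℕ) + 1)
       + ∑ i ∈ Finset.Icc (m + 1) n, ((a ⟨m + 1, by omega⟩).val : ℝ) / (b : ℝ) ^ i)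

/-- The two-dimensional digital net (in `[0,1]²`) with generating matrices
`C₁, C₂ ∈ ℤ_b^{ℕ×m}`. -/
def netPts2 (b m : ℕ) (C₁ C₂ : ℕ → Fin m → ZMod b) : Multiset (ℝ × ℝ) :=
  (Multiset.range (b ^ m)).map fun n =>
    (projG b (netPt b m 2 ![C₁, C₂] n 0), projG b (netPt b m 2 ![C₁, C₂] n 1))

/-- `l`-th row (`l` 1-based) of the first generating matrix `C₁` of the truncated
symmetrized Hammersley point set: `(C₁)_{l,j} = 1` iff (`j = l` and `l ≤ m`) or `j = m+1`. -/
def hamRow1 (b m : ℕ) (l : ℕ) : Fin (m + 2) → ZMod b := fun j =>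
  if ((j : ℕ) + 1 = l ∧ l ≤ m) ∨ (j : ℕ) + 1 = m + 1 then 1 else 0

/-- `l`-th row (`l` 1-based) of the second generating matrix `C₂`:
`(C₂)_{l,j} = 1` iff (`j = m+1-l` and `l ≤ m`) or `j = m+2`. -/
def hamRow2 (b m : ℕ) (l : ℕ) : Fin (m + 2) → ZMod b := fun j =>
  if ((j : ℕ) + 1 = m + 1 - l ∧ l ≤ m) ∨ (j : ℕ) + 1 = m + 2 then 1 else 0

/-- row selector for the two matrices. -/
def hamRow (b m : ℕ) : Fin 2 → ℕ → Fin (m + 2) → ZMod b := ![hamRow1 b m, hamRow2 b m]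

/-- The truncated symmetrized Hammersley point set, given as the two-dimensional digital
net with the `n × (m+2)` generating matrices `C₁, C₂` above. -/
def truncHamPts (b m n : ℕ) : Multiset (ℝ × ℝ) :=
  (Multiset.range (b ^ (m + 2))).map fun u =>
    (∑ i ∈ Finset.range n,
        ((∑ t : Fin (m + 2), zdgt b u (t : ℕ) * hamRow1 b m (i + 1) t).val : ℝ)
          / (b : ℝ) ^ (i + 1),
     ∑ i ∈ Finset.range n,
        ((∑ t : Fin (m + 2), zdgt b u (t : ℕ) * hamRow2 b m (i + 1) t).val : ℝ)
          / (b : ℝ) ^ (i + 1))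

end Sym

namespace Sym

/-! ### Digit reversal with a digital shift -/

section DigitReversal

variable {b : ℕ}

/-- The number whose `n` base-`b` digits are those of `c` in reversed order, each shifted by `d`
modulo `b`. -/
def revShift (d : ZMod b) : ℕ → ℕ → ℕ
  | 0, _ => 0
  | n + 1, c => (((c % b : ℕ) : ZMod b) + d).val * b ^ n + revShift d n (c / b)

lemma mul_pow_add_lt_iff {n j k w l : ℕ} (hw : w < b ^ n) (hl : l < b ^ n) :
    j * b ^ n + w < k * b ^ n + l ↔ j < k ∨ (j = k ∧ w < l) := by
  rcases lt_trichotomy j k with h | rfl | h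
  · have := Nat.mul_le_mul_right (b ^ n) (Nat.succ_le_of_lt h)
    rw [Nat.succ_mul] at this
    exact iff_of_true (by omega) (Or.inl h)
  · simp
  · have := Nat.mul_le_mul_right (b ^ n) (Nat.succ_le_of_lt h)
    rw [Nat.succ_mul] at this
    exact iff_of_false (by omega) (by omega)

variable [NeZero b]

lemma revShift_lt (d : ZMod b) (n c : ℕ) : revShift d n c < b ^ n := by
  induction n generalizing c with
  | zero => simp [revShift]
  | succ n ih =>
    have h1 := ih (c / b)
    have h2 : (((c % b : ℕ) : ZMod b) + d).val + 1 ≤ b := ZMod.val_lt _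
    have h3 := Nat.mul_le_mul_right (b ^ n) h2
    rw [revShift, pow_succ']
    linarith [add_mul (((c % b : ℕ) : ZMod b) + d).val 1 (b ^ n)]

lemma revShift_injOn (d : ZMod b) (n : ℕ) :
    Set.InjOn (revShift d n) (Finset.range (b ^ n) : Set ℕ) := by
  induction n with
  | zero => intro x hx y hy _; simp at hx hy; omega
  | succ n ih =>
    intro x hx y hy h
    have hb : 0 < b := Nat.pos_of_neZero b
    simp only [Finset.coe_range, Set.mem_Iio, pow_succ] at hx hy
    simp only [revShift] at h
    have hwx := revShift_lt d n (x / b)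
    have hwy := revShift_lt d n (y / b)
    have h1 := congrArg (· / b ^ n) h
    have h2 := congrArg (· % b ^ n) h
    have hpos : 0 < b ^ n := by positivity
    simp only [Nat.mul_comm _ (b ^ n), Nat.mul_add_div hpos, Nat.div_eq_of_lt hwx,
      Nat.div_eq_of_lt hwy, add_zero, Nat.mul_add_mod, Nat.mod_eq_of_lt hwx,
      Nat.mod_eq_of_lt hwy] at h1 h2
    have h3 : x / b = y / b := by
      refine ih ?_ ?_ h2 <;> simp only [Finset.coe_range, Set.mem_Iio] <;>
        exact Nat.div_lt_of_lt_mul (by linarith [Nat.mul_comm b (b ^ n)])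
    have h4 : x % b = y % b := by
      have := add_right_cancel (ZMod.val_injective b h1)
      have := congrArg ZMod.val this
      rwa [ZMod.val_natCast, ZMod.val_natCast, Nat.mod_mod, Nat.mod_mod] at this
    rw [← Nat.div_add_mod x b, ← Nat.div_add_mod y b, h3, h4]

lemma revShift_sum (d : ZMod b) (n : ℕ) (g : ℕ → ZMod b) :
    revShift d n (∑ i ∈ Finset.range n, (g i).val * b ^ i)
      = ∑ i ∈ Finset.range n, (g i + d).val * b ^ (n - 1 - i) := by
  induction n generalizing g with
  | zero => simp [revShift]
  | succ n ih =>
    have hb : 0 < b := Nat.pos_of_neZero b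
    have h : ∑ i ∈ Finset.range (n + 1), (g i).val * b ^ i
        = b * (∑ i ∈ Finset.range n, (g (i + 1)).val * b ^ i) + (g 0).val := by
      rw [Finset.sum_range_succ', Finset.mul_sum]
      simp only [pow_zero, mul_one, add_left_inj]
      exact Finset.sum_congr rfl fun i _ => by ring
    rw [revShift, h, Nat.mul_add_mod, Nat.mod_eq_of_lt (ZMod.val_lt _), Nat.mul_add_div hb,
      Nat.div_eq_of_lt (ZMod.val_lt _), add_zero, ih, Finset.sum_range_succ', add_comm]
    simp only [ZMod.natCast_val, ZMod.cast_id', id_eq]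
    congr 1
    refine Finset.sum_congr rfl fun i hi => ?_
    congr 2
    omega

lemma sum_range_natCast_zmod {M : Type*} [AddCommMonoid M] (f : ZMod b → M) :
    ∑ j ∈ Finset.range b, f (j : ZMod b) = ∑ d, f d := by
  refine Finset.sum_bij' (fun j _ => (j : ZMod b)) (fun d _ => d.val) ?_ ?_ ?_ ?_ ?_
  · simp
  · intro d _; simpa using ZMod.val_lt d
  · intro j hj; exact ZMod.val_cast_of_lt (by simpa using hj)
  · simp
  · simp

lemma sum_range_mul_add {M : Type*} [AddCommMonoid M] (f : ℕ → M) (a k n : ℕ) :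
    ∑ c ∈ Finset.range (a * n + k), f c
      = ∑ c ∈ Finset.range n, ∑ e ∈ Finset.range a, f (a * c + e)
        + ∑ e ∈ Finset.range k, f (a * n + e) := by
  rw [Finset.sum_range_add]
  congr 1
  induction n with
  | zero => simp
  | succ n ih => rw [Nat.mul_succ, Finset.sum_range_add, ih, Finset.sum_range_succ]

/-! ### The discrepancy of shifted Hammersley point sets at grid points -/

/-- The deviation of the indicator of `revShift d n c < l` from its mean value `l / b ^ n`. -/
def shiftDefect (n : ℕ) (d : ZMod b) (c l : ℕ) : ℝ :=
  (if revShift d n c < l then 1 else 0) - (l : ℝ) / (b : ℝ) ^ n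

/-- The sum of `shiftDefect` over all digital shifts. -/
def totalDefect (b : ℕ) [NeZero b] (n c l : ℕ) : ℝ := ∑ d : ZMod b, shiftDefect n d c l

/-- The unnormalized local discrepancy at the grid point `(k, l) / b ^ n` of the union over all
digital shifts of the `b ^ n` point Hammersley sets. -/
def gridDisc (b : ℕ) [NeZero b] (n k l : ℕ) : ℝ := ∑ c ∈ Finset.range k, totalDefect b n c l

lemma abs_shiftDefect_le (n : ℕ) (d : ZMod b) (c : ℕ) {l : ℕ} (hl : l < b ^ n) :
    |shiftDefect n d c l| ≤ 1 := by
  have hpos : (0 : ℝ) < (b : ℝ) ^ n := by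
    have : 0 < b := Nat.pos_of_neZero b
    positivity
  have h1 : (l : ℝ) / (b : ℝ) ^ n ≤ 1 := by
    rw [div_le_one hpos]; exact_mod_cast hl.le
  have h0 : 0 ≤ (l : ℝ) / (b : ℝ) ^ n := by positivity
  rw [shiftDefect, abs_le]
  split_ifs <;> constructor <;> linarith

lemma abs_totalDefect_le (n c : ℕ) {l : ℕ} (hl : l < b ^ n) : |totalDefect b n c l| ≤ b := by
  refine (Finset.abs_sum_le_sum_abs _ _).trans
    ((Finset.sum_le_sum fun d _ => abs_shiftDefect_le n d c hl).trans ?_)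
  simp [ZMod.card]

lemma totalDefect_succ (n c e k l : ℕ) (he : e < b) (hk : k < b) (hl : l < b ^ n) :
    totalDefect b (n + 1) (b * c + e) (k * b ^ n + l)
      = shiftDefect n ((k : ZMod b) - (e : ZMod b)) c l := by
  have hb : 0 < b := Nat.pos_of_neZero b
  have hbR : (b : ℝ) ≠ 0 := by positivity
  have hind : ∀ d : ZMod b,
      (if revShift d (n + 1) (b * c + e) < k * b ^ n + l then (1 : ℝ) else 0)
      = (if ((e : ZMod b) + d).val < k then 1 else 0)
        + (if (e : ZMod b) + d = k then
            (if revShift ((k : ZMod b) - (e : ZMod b)) n c < l then 1 else 0) else 0) := by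
    intro d
    rw [revShift, Nat.mul_add_mod, Nat.mod_eq_of_lt he, Nat.mul_add_div hb,
      Nat.div_eq_of_lt he, add_zero]
    simp only [mul_pow_add_lt_iff (revShift_lt d n c) hl]
    by_cases h : (e : ZMod b) + d = k
    · have h' : ((e : ZMod b) + d).val = k := by rw [h, ZMod.val_cast_of_lt hk]
      have hd : d = (k : ZMod b) - (e : ZMod b) := by rw [← h]; ring
      simp [h, ← hd, Nat.mod_eq_of_lt hk]
    · have h' : ((e : ZMod b) + d).val ≠ k := fun h' => h (by rw [← h']; simp)
      simp [h', h]
  have hcount : ∑ d : ZMod b, (if ((e : ZMod b) + d).val < k then (1 : ℝ) else 0) = k := by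
    refine (Equiv.sum_comp (Equiv.addLeft (e : ZMod b))
      (fun d : ZMod b => if d.val < k then (1 : ℝ) else 0)).trans ?_
    rw [← sum_range_natCast_zmod]
    have : ∀ j ∈ Finset.range b, (if ((j : ZMod b)).val < k then (1 : ℝ) else 0)
        = if j < k then 1 else 0 := fun j hj => by
      rw [ZMod.val_cast_of_lt (by simpa using hj)]
    rw [Finset.sum_congr rfl this, Finset.sum_boole]
    have : (Finset.range b).filter (· < k) = Finset.range k := by
      ext j; simp; omega
    simp [this]
  have heq : ∀ d : ZMod b, (e : ZMod b) + d = k ↔ d = (k : ZMod b) - (e : ZMod b) := fun d => by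
    rw [eq_sub_iff_add_eq, add_comm]
  simp only [totalDefect, shiftDefect, Finset.sum_sub_distrib, hind, Finset.sum_add_distrib,
    hcount, heq, Finset.sum_ite_eq', Finset.mem_univ, if_true]
  simp only [Finset.sum_const, Finset.card_univ, ZMod.card, nsmul_eq_mul]
  push_cast
  field_simp
  ring

lemma sum_shiftDefect_sub_right (n : ℕ) (k : ZMod b) (c l : ℕ) :
    ∑ e ∈ Finset.range b, shiftDefect n (k - (e : ZMod b)) c l = totalDefect b n c l := by
  rw [sum_range_natCast_zmod (fun e => shiftDefect n (k - e) c l)]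
  exact (Equiv.subLeft k).sum_comp (fun d => shiftDefect n d c l)

lemma sum_shiftDefect_sub_left (n : ℕ) (e : ZMod b) (c l : ℕ) :
    ∑ k ∈ Finset.range b, shiftDefect n ((k : ZMod b) - (e : ZMod b)) c l = totalDefect b n c l := by
  rw [sum_range_natCast_zmod (fun k => shiftDefect n (k - e) c l)]
  exact (Equiv.subRight e).sum_comp (fun d => shiftDefect n d c l)

lemma gridDisc_succ (n c e k l : ℕ) (he : e < b) (hk : k < b) (hl : l < b ^ n) :
    gridDisc b (n + 1) (b * c + e) (k * b ^ n + l)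
      = gridDisc b n c l
        + ∑ i ∈ Finset.range e, shiftDefect n ((k : ZMod b) - (i : ZMod b)) c l := by
  simp only [gridDisc]
  rw [sum_range_mul_add]
  congr 1
  · refine Finset.sum_congr rfl fun c' _ => ?_
    rw [← sum_shiftDefect_sub_right n (k : ZMod b)]
    exact Finset.sum_congr rfl fun i hi =>
      totalDefect_succ n c' i k l (by simpa using hi) hk hl
  · exact Finset.sum_congr rfl fun i hi =>
      totalDefect_succ n c i k l ((Finset.mem_range.mp hi).trans he) hk hl

/-- A martingale, with respect to the leading digits of `k` and the trailing digits of `l`, which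
stays within bounded distance of `gridDisc`. -/
def gridMart (b : ℕ) [NeZero b] (n k l : ℕ) : ℝ := gridDisc b n k l + totalDefect b n k l / 2

/-- The increment of `gridMart`. -/
def gridIncr (b : ℕ) [NeZero b] (n c l e k : ℕ) : ℝ :=
  ∑ i ∈ Finset.range e, shiftDefect n ((k : ZMod b) - (i : ZMod b)) c l
    + shiftDefect n ((k : ZMod b) - (e : ZMod b)) c l / 2 - totalDefect b n c l / 2

lemma gridMart_succ (n c e k l : ℕ) (he : e < b) (hk : k < b) (hl : l < b ^ n) :
    gridMart b (n + 1) (b * c + e) (k * b ^ n + l)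
      = gridMart b n c l + gridIncr b n c l e k := by
  rw [gridMart, gridMart, gridIncr, gridDisc_succ n c e k l he hk hl,
    totalDefect_succ n c e k l he hk hl]
  ring

lemma abs_gridIncr_le (n c e k : ℕ) {l : ℕ} (he : e < b) (hl : l < b ^ n) :
    |gridIncr b n c l e k| ≤ 2 * b := by
  have h1 : |∑ i ∈ Finset.range e, shiftDefect n ((k : ZMod b) - (i : ZMod b)) c l| ≤ e := by
    refine (Finset.abs_sum_le_sum_abs _ _).trans
      ((Finset.sum_le_sum fun i _ => abs_shiftDefect_le n _ c hl).trans ?_)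
    simp
  have h2 := abs_shiftDefect_le n ((k : ZMod b) - (e : ZMod b)) c hl
  have h3 := abs_totalDefect_le n c hl
  have he' : (e : ℝ) + 1 ≤ b := by exact_mod_cast he
  have he0 : (0 : ℝ) ≤ e := by positivity
  rw [abs_le] at h1 h2 h3 ⊢
  rw [gridIncr]
  constructor <;> linarith [h1.1, h1.2, h2.1, h2.2, h3.1, h3.2]

lemma sum_gridIncr (n c l : ℕ) :
    ∑ x ∈ Finset.range b ×ˢ Finset.range b, gridIncr b n c l x.1 x.2 = 0 := by
  rw [Finset.sum_product]
  have h : ∀ e ∈ Finset.range b, ∑ k ∈ Finset.range b, gridIncr b n c l e k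
      = ((e : ℝ) + 1 / 2 - b / 2) * totalDefect b n c l := by
    intro e _
    simp only [gridIncr, Finset.sum_sub_distrib, Finset.sum_add_distrib]
    rw [Finset.sum_comm, ← Finset.sum_div]
    simp only [sum_shiftDefect_sub_left, Finset.sum_const, Finset.card_range, nsmul_eq_mul]
    ring
  rw [Finset.sum_congr rfl h, ← Finset.sum_mul, Finset.sum_sub_distrib, Finset.sum_add_distrib]
  have hg : ∀ n : ℕ, ∑ i ∈ Finset.range n, (i : ℝ) = n * (n - 1) / 2 := fun n => by
    induction n with
    | zero => simp
    | succ n ih => rw [Finset.sum_range_succ, ih]; push_cast; ring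
  rw [hg]
  simp only [Finset.sum_const, Finset.card_range, nsmul_eq_mul]
  ring

/-! ### Exponential moments -/

lemma sum_exp_le_of_sum_eq_zero {ι : Type*} (s : Finset ι) (D : ι → ℝ) {B : ℝ} (hB : 0 < B)
    (hD : ∀ i ∈ s, |D i| ≤ B) (h0 : ∑ i ∈ s, D i = 0) (t : ℝ) :
    ∑ i ∈ s, Real.exp (t * D i) ≤ s.card * Real.exp ((t * B) ^ 2 / 2) := by
  have h : ∀ i ∈ s, Real.exp (t * D i)
      ≤ Real.cosh (t * B) + Real.sinh (t * B) / B * D i := by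
    intro i hi
    have hi := abs_le.mp (hD i hi)
    have hl : -1 ≤ D i / B := by rw [le_div_iff₀ hB]; linarith
    have hu : D i / B ≤ 1 := by rw [div_le_one hB]; linarith
    have := convexOn_exp.2 (Set.mem_univ (t * B)) (Set.mem_univ (-(t * B)))
      (show 0 ≤ (1 + D i / B) / 2 by linarith) (show 0 ≤ (1 - D i / B) / 2 by linarith) (by ring)
    simp only [smul_eq_mul] at this
    calc Real.exp (t * D i)
        = Real.exp ((1 + D i / B) / 2 * (t * B) + (1 - D i / B) / 2 * -(t * B)) := by
          congr 1; field_simp; ring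
      _ ≤ _ := this
      _ = _ := by rw [Real.cosh_eq, Real.sinh_eq]; ring
  calc ∑ i ∈ s, Real.exp (t * D i)
      ≤ ∑ i ∈ s, (Real.cosh (t * B) + Real.sinh (t * B) / B * D i) := Finset.sum_le_sum h
    _ = s.card * Real.cosh (t * B) := by
      rw [Finset.sum_add_distrib, ← Finset.mul_sum, h0]; simp
    _ ≤ _ := by gcongr; exact Real.cosh_le_exp_half_sq _

lemma sum_exp_gridMart_le (t : ℝ) (n : ℕ) :
    ∑ k ∈ Finset.range (b ^ n), ∑ l ∈ Finset.range (b ^ n), Real.exp (t * gridMart b n k l)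
      ≤ ((b : ℝ) ^ 2 * Real.exp ((t * (2 * b)) ^ 2 / 2)) ^ n := by
  have hb : 0 < b := Nat.pos_of_neZero b
  induction n with
  | zero => simp [gridMart, gridDisc, totalDefect, shiftDefect]
  | succ n ih =>
    have h1 := sum_range_mul_add
      (fun k => ∑ l ∈ Finset.range (b ^ (n + 1)), Real.exp (t * gridMart b (n + 1) k l))
      b 0 (b ^ n)
    have h2 : ∀ k, ∑ l ∈ Finset.range (b ^ (n + 1)), Real.exp (t * gridMart b (n + 1) k l)
        = ∑ j ∈ Finset.range b, ∑ l ∈ Finset.range (b ^ n),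
            Real.exp (t * gridMart b (n + 1) k (j * b ^ n + l)) := by
      intro k
      have := sum_range_mul_add (fun l => Real.exp (t * gridMart b (n + 1) k l)) (b ^ n) 0 b
      simp only [add_zero, Finset.range_zero, Finset.sum_empty] at this
      rw [pow_succ, this]
      simp only [mul_comm]
    simp only [add_zero, Finset.range_zero, Finset.sum_empty, h2] at h1
    have h3 : ∀ c ∈ Finset.range (b ^ n), ∀ l ∈ Finset.range (b ^ n),
        ∑ e ∈ Finset.range b, ∑ j ∈ Finset.range b,
          Real.exp (t * gridMart b (n + 1) (b * c + e) (j * b ^ n + l))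
        ≤ Real.exp (t * gridMart b n c l)
          * ((b : ℝ) ^ 2 * Real.exp ((t * (2 * b)) ^ 2 / 2)) := by
      intro c _ l hl
      rw [Finset.mem_range] at hl
      have h4 : ∀ e ∈ Finset.range b, ∀ j ∈ Finset.range b,
          Real.exp (t * gridMart b (n + 1) (b * c + e) (j * b ^ n + l))
          = Real.exp (t * gridMart b n c l) * Real.exp (t * gridIncr b n c l e j) := by
        intro e he j hj
        rw [gridMart_succ n c e j l (by simpa using he) (by simpa using hj) hl, mul_add,
          Real.exp_add]
      rw [Finset.sum_congr rfl fun e he => Finset.sum_congr rfl (h4 e he)]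
      simp only [← Finset.mul_sum]
      rw [← Finset.sum_product']
      refine mul_le_mul_of_nonneg_left ?_ (Real.exp_pos _).le
      have h5 := sum_exp_le_of_sum_eq_zero (Finset.range b ×ˢ Finset.range b)
        (fun x => gridIncr b n c l x.1 x.2) (B := 2 * b) (by positivity)
        (fun x hx => abs_gridIncr_le n c x.1 x.2
          (Finset.mem_range.mp (Finset.mem_product.mp hx).1) hl)
        (sum_gridIncr n c l) t
      refine h5.trans_eq ?_
      rw [Finset.card_product, Finset.card_range]
      push_cast
      ring
    calc _ = ∑ c ∈ Finset.range (b ^ n), ∑ l ∈ Finset.range (b ^ n),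
          ∑ e ∈ Finset.range b, ∑ j ∈ Finset.range b,
            Real.exp (t * gridMart b (n + 1) (b * c + e) (j * b ^ n + l)) := by
          rw [show Finset.range (b ^ (n + 1)) = Finset.range (b * b ^ n) by rw [pow_succ'],
            ← show Finset.range (b ^ (n + 1)) = Finset.range (b * b ^ n) by rw [pow_succ']]
          simp only [h2]
          rw [pow_succ', h1]
          refine Finset.sum_congr rfl fun c _ => ?_
          rw [Finset.sum_congr rfl fun e _ => Finset.sum_comm, Finset.sum_comm]
      _ ≤ ∑ c ∈ Finset.range (b ^ n), ∑ l ∈ Finset.range (b ^ n),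
          Real.exp (t * gridMart b n c l)
          * ((b : ℝ) ^ 2 * Real.exp ((t * (2 * b)) ^ 2 / 2)) :=
          Finset.sum_le_sum fun c hc => Finset.sum_le_sum (h3 c hc)
      _ ≤ _ := by
          simp only [← Finset.sum_mul]
          rw [pow_succ]
          exact mul_le_mul_of_nonneg_right ih (by positivity)

end DigitReversal

/-! ### Local discrepancy of the symmetrized Hammersley point set -/

lemma abs_ite_and_sub_ite_and_le (p q p' q' : Prop) [Decidable p]
    [Decidable q] [Decidable p'] [Decidable q'] :
    |(if p ∧ q then (1 : ℝ) else 0) - (if p' ∧ q' then 1 else 0)|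
      ≤ |(if p then (1 : ℝ) else 0) - (if p' then 1 else 0)|
        + |(if q then (1 : ℝ) else 0) - (if q' then 1 else 0)| := by
  by_cases p <;> by_cases q <;> by_cases p' <;> by_cases q' <;> simp [*]

lemma pow_div_pow_succ_reflect {b : ℕ} (hb : b ≠ 0) (x : ℝ) {i m : ℕ} (hi : i < m) :
    x / (b : ℝ) ^ (i + 1) = x * (b : ℝ) ^ (m - 1 - i) / (b : ℝ) ^ m := by
  have hbR : (b : ℝ) ≠ 0 := by exact_mod_cast hb
  rw [div_eq_div_iff (by positivity) (by positivity), mul_assoc, ← pow_add]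
  congr 2
  omega

section LocalDiscrepancy

variable {b : ℕ} [NeZero b]

/-- The integer part of `b ^ m * x`, for the first coordinate `x` of the point with index `a`. -/
def leadIndex {m : ℕ} (a : Fin (m + 2) → ZMod b) : Fin (b ^ m) :=
  finFunctionFinEquiv fun i : Fin m =>
    ⟨(a ⟨m - 1 - (i : ℕ), by omega⟩ + a ⟨m, by omega⟩).val, ZMod.val_lt _⟩

lemma bijective_leadIndex (m : ℕ) :
    Function.Bijective fun a : Fin (m + 2) → ZMod b =>
      (leadIndex a, a ⟨m, by omega⟩, a ⟨m + 1, by omega⟩) := by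
  rw [Fintype.bijective_iff_injective_and_card]
  refine ⟨fun a a' h => ?_, ?_⟩
  · simp only [Prod.mk.injEq, leadIndex, EmbeddingLike.apply_eq_iff_eq] at h
    obtain ⟨h1, h2, h3⟩ := h
    funext j
    obtain hj | hj | hj : (j : ℕ) < m ∨ (j : ℕ) = m ∨ (j : ℕ) = m + 1 := by omega
    · have h4 := congrFun h1 ⟨m - 1 - j, by omega⟩
      simp only [Fin.mk.injEq] at h4
      have h5 := ZMod.val_injective b h4
      rw [h2] at h5
      have h6 := add_right_cancel h5
      have h7 : (⟨m - 1 - (m - 1 - (j : ℕ)), by omega⟩ : Fin (m + 2)) = j := by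
        ext; simp only; omega
      rwa [h7] at h6
    · rwa [show (⟨m, by omega⟩ : Fin (m + 2)) = j from Fin.ext hj.symm] at h2
    · rwa [show (⟨m + 1, by omega⟩ : Fin (m + 2)) = j from Fin.ext hj.symm] at h3
  · simp only [Fintype.card_pi, ZMod.card, Fintype.card_prod, Fintype.card_fin,
      Finset.prod_const, Finset.card_univ]
    ring

lemma hammersley_fst (m : ℕ) (a : Fin (m + 2) → ZMod b) :
    ∑ i : Fin m, ((a (Fin.castLE (by omega) i) + a ⟨m, by omega⟩).val : ℝ)
        / (b : ℝ) ^ ((i : ℕ) + 1)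
      + ((a ⟨m, by omega⟩).val : ℝ) / ((b : ℝ) ^ m * ((b : ℝ) - 1))
    = (((leadIndex a : Fin (b ^ m)) : ℕ) + ((a ⟨m, by omega⟩).val : ℝ) / ((b : ℝ) - 1))
        / (b : ℝ) ^ m := by
  rw [add_div, div_div, mul_comm ((b : ℝ) - 1)]
  congr 1
  rw [leadIndex, finFunctionFinEquiv_apply, ← Equiv.sum_comp Fin.revPerm]
  push_cast
  rw [Finset.sum_div]
  refine Finset.sum_congr rfl fun i _ => ?_
  have hi : ((Fin.revPerm i : Fin m) : ℕ) = m - 1 - i := by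
    simp only [Fin.revPerm_apply, Fin.val_rev]; omega
  rw [pow_div_pow_succ_reflect (NeZero.ne b) _ (Fin.is_lt _), hi]
  congr 3
  · congr 4
    ext
    simp only [Fin.val_castLE, hi]
  · omega

lemma hammersley_snd (m : ℕ) (a : Fin (m + 2) → ZMod b) :
    ∑ i : Fin m, ((a ⟨m - 1 - (i : ℕ), by omega⟩ + a ⟨m + 1, by omega⟩).val : ℝ)
        / (b : ℝ) ^ ((i : ℕ) + 1)
      + ((a ⟨m + 1, by omega⟩).val : ℝ) / ((b : ℝ) ^ m * ((b : ℝ) - 1))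
    = ((revShift (a ⟨m + 1, by omega⟩ - a ⟨m, by omega⟩) m (leadIndex a) : ℕ)
        + ((a ⟨m + 1, by omega⟩).val : ℝ) / ((b : ℝ) - 1)) / (b : ℝ) ^ m := by
  rw [add_div, div_div, mul_comm ((b : ℝ) - 1)]
  congr 1
  have h : ((leadIndex a : Fin (b ^ m)) : ℕ) = ∑ i ∈ Finset.range m,
      (if h : i < m then a ⟨m - 1 - i, by omega⟩ + a ⟨m, by omega⟩ else 0).val * b ^ i := by
    rw [leadIndex, finFunctionFinEquiv_apply, Finset.sum_range]
    refine Finset.sum_congr rfl fun i _ => ?_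
    simp
  rw [h, revShift_sum, Finset.sum_range]
  push_cast
  rw [Finset.sum_div]
  refine Finset.sum_congr rfl fun i _ => ?_
  rw [pow_div_pow_succ_reflect (NeZero.ne b) _ i.is_lt]
  simp

lemma abs_ite_add_lt_sub_ite_lt_floor_le (c : ℕ) {θ τ : ℝ} (h0 : 0 ≤ θ) (h1 : θ ≤ 1)
    (hτ : 0 ≤ τ) :
    |(if (c : ℝ) + θ < τ then (1 : ℝ) else 0) - (if c < ⌊τ⌋₊ then 1 else 0)|
      ≤ if c = ⌊τ⌋₊ ∨ c + 1 = ⌊τ⌋₊ then 1 else 0 := by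
  have hl := Nat.floor_le hτ
  have hu := Nat.lt_floor_add_one τ
  by_cases hE : c = ⌊τ⌋₊ ∨ c + 1 = ⌊τ⌋₊
  · rw [if_pos hE]
    split_ifs <;> simp
  · rw [if_neg hE]
    push Not at hE
    by_cases hc : c < ⌊τ⌋₊
    · have h : c + 2 ≤ ⌊τ⌋₊ := by omega
      have h' : (c : ℝ) + 2 ≤ ⌊τ⌋₊ := by exact_mod_cast h
      rw [if_pos (by linarith), if_pos hc]; simp
    · have h : ⌊τ⌋₊ + 1 ≤ c := by omega
      have h' : (⌊τ⌋₊ : ℝ) + 1 ≤ c := by exact_mod_cast h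
      rw [if_neg (by linarith), if_neg hc]; simp

lemma sum_ite_eq_or_succ_eq_le {s : Finset ℕ} {f : ℕ → ℕ} (hf : Set.InjOn f s) (k : ℕ) :
    ∑ c ∈ s, (if f c = k ∨ f c + 1 = k then (1 : ℝ) else 0) ≤ 2 := by
  rw [Finset.sum_boole]
  have h : (s.filter fun c => f c = k ∨ f c + 1 = k).card ≤ ({k, k - 1} : Finset ℕ).card := by
    refine Finset.card_le_card_of_injOn f ?_ (hf.mono fun x hx => (Finset.mem_filter.mp hx).1)
    intro c hc
    simp only [Finset.coe_filter, Set.mem_ofPred_eq] at hc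
    simp only [Finset.coe_insert, Finset.coe_singleton, Set.mem_insert_iff,
      Set.mem_singleton_iff]
    omega
  exact_mod_cast h.trans Finset.card_le_two

lemma abs_count_sub_grid_count_le (m : ℕ) (d : ZMod b) {θ η τ σ : ℝ} (hθ : θ ∈ Set.Icc 0 1)
    (hη : η ∈ Set.Icc 0 1) (hτ : 0 ≤ τ) (hσ : 0 ≤ σ) (hτb : ⌊τ⌋₊ ≤ b ^ m) :
    |∑ c : Fin (b ^ m), (if ((c : ℕ) : ℝ) + θ < τ ∧ (revShift d m c : ℝ) + η < σ
          then (1 : ℝ) else 0)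
        - ∑ c ∈ Finset.range ⌊τ⌋₊, (if revShift d m c < ⌊σ⌋₊ then (1 : ℝ) else 0)| ≤ 4 := by
  have h1 : ∑ c ∈ Finset.range ⌊τ⌋₊, (if revShift d m c < ⌊σ⌋₊ then (1 : ℝ) else 0)
      = ∑ c ∈ Finset.range (b ^ m),
        (if c < ⌊τ⌋₊ ∧ revShift d m c < ⌊σ⌋₊ then (1 : ℝ) else 0) := by
    simp only [ite_and]
    rw [← Finset.sum_filter (fun c => c < ⌊τ⌋₊)]
    congr 1
    ext c
    simp only [Finset.mem_range, Finset.mem_filter]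
    omega
  rw [h1, ← Finset.sum_range (fun c : ℕ => if (c : ℝ) + θ < τ ∧ (revShift d m c : ℝ) + η < σ
          then (1 : ℝ) else 0), ← Finset.sum_sub_distrib]
  refine (Finset.abs_sum_le_sum_abs _ _).trans ?_
  refine (Finset.sum_le_sum fun c _ => (abs_ite_and_sub_ite_and_le _ _ _ _).trans
    (add_le_add (abs_ite_add_lt_sub_ite_lt_floor_le c hθ.1 hθ.2 hτ)
      (abs_ite_add_lt_sub_ite_lt_floor_le (revShift d m c) hη.1 hη.2 hσ))).trans ?_
  rw [Finset.sum_add_distrib]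
  refine (add_le_add (sum_ite_eq_or_succ_eq_le (f := id) (Set.injOn_id _) ⌊τ⌋₊)
    (sum_ite_eq_or_succ_eq_le (revShift_injOn d m) ⌊σ⌋₊)).trans_eq (by norm_num)

lemma sum_shift_grid_count (m k l : ℕ) :
    ∑ u : ZMod b, ∑ v : ZMod b, ∑ c ∈ Finset.range k,
        (if revShift (v - u) m c < l then (1 : ℝ) else 0)
      = b * gridDisc b m k l + (b : ℝ) ^ 2 * (k * l / (b : ℝ) ^ m) := by
  have h : ∀ u : ZMod b, ∑ v : ZMod b, ∑ c ∈ Finset.range k,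
        (if revShift (v - u) m c < l then (1 : ℝ) else 0)
      = gridDisc b m k l + b * (k * l / (b : ℝ) ^ m) := by
    intro u
    refine ((Equiv.subRight u).sum_comp (fun d : ZMod b => ∑ c ∈ Finset.range k,
        (if revShift d m c < l then (1 : ℝ) else 0))).trans ?_
    simp only [gridDisc, totalDefect, shiftDefect]
    rw [Finset.sum_comm]
    simp only [Finset.sum_sub_distrib, Finset.sum_const, Finset.card_univ, ZMod.card,
      Finset.card_range, nsmul_eq_mul]
    ring
  simp only [h, Finset.sum_const, Finset.card_univ, ZMod.card, nsmul_eq_mul]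
  ring

lemma card_hamSymPts (m : ℕ) : (hamSymPts b m).card = b ^ (m + 2) := by
  simp [hamSymPts, ZMod.card]

lemma sum_hamSymPts (hb : 1 < b) (m : ℕ) (t : ℝ × ℝ) :
    ((hamSymPts b m).map fun x =>
        if 0 ≤ x.1 ∧ x.1 < t.1 ∧ 0 ≤ x.2 ∧ x.2 < t.2 then (1 : ℝ) else 0).sum
      = ∑ u : ZMod b, ∑ v : ZMod b, ∑ c : Fin (b ^ m),
          if ((c : ℕ) : ℝ) + (u.val : ℝ) / ((b : ℝ) - 1) < (b : ℝ) ^ m * t.1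
              ∧ (revShift (v - u) m c : ℝ) + (v.val : ℝ) / ((b : ℝ) - 1) < (b : ℝ) ^ m * t.2
            then (1 : ℝ) else 0 := by
  have hb1 : (0 : ℝ) < (b : ℝ) - 1 := by
    have : (1 : ℝ) < b := by exact_mod_cast hb
    linarith
  have hpos : (0 : ℝ) < (b : ℝ) ^ m := by positivity
  have hR := (Equiv.ofBijective _ (bijective_leadIndex (b := b) m)).sum_comp
    (fun x : Fin (b ^ m) × ZMod b × ZMod b =>
      if ((x.1 : ℕ) : ℝ) + (x.2.1.val : ℝ) / ((b : ℝ) - 1) < (b : ℝ) ^ m * t.1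
          ∧ (revShift (x.2.2 - x.2.1) m x.1 : ℝ) + (x.2.2.val : ℝ) / ((b : ℝ) - 1)
            < (b : ℝ) ^ m * t.2
        then (1 : ℝ) else 0)
  simp only [Fintype.sum_prod_type] at hR
  rw [Finset.sum_comm] at hR
  rw [Finset.sum_congr rfl fun u _ => Finset.sum_comm, ← hR, hamSymPts, Multiset.map_map]
  refine Finset.sum_congr rfl fun a _ => ?_
  simp only [Function.comp_apply, Equiv.ofBijective_apply, hammersley_fst, hammersley_snd,
    div_lt_iff₀ hpos]
  congr 1
  rw [eq_iff_iff]
  constructor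
  · rintro ⟨_, h1, _, h2⟩
    exact ⟨by linarith, by linarith⟩
  · rintro ⟨h1, h2⟩
    exact ⟨by positivity, by linarith, by positivity, by linarith⟩

lemma abs_disc2_sub_gridMart_le (hb : 1 < b) (m : ℕ) {t : ℝ × ℝ}
    (h1 : t.1 ∈ Set.Ico (0 : ℝ) 1) (h2 : t.2 ∈ Set.Ico (0 : ℝ) 1) :
    |(b : ℝ) ^ (m + 2) * disc2 (hamSymPts b m) t
        - b * gridMart b m ⌊(b : ℝ) ^ m * t.1⌋₊ ⌊(b : ℝ) ^ m * t.2⌋₊| ≤ 7 * (b : ℝ) ^ 2 := by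
  have hb1 : (0 : ℝ) < (b : ℝ) - 1 := by
    have : (1 : ℝ) < b := by exact_mod_cast hb
    linarith
  have hpos : (0 : ℝ) < (b : ℝ) ^ m := by positivity
  set τ := (b : ℝ) ^ m * t.1 with hτ
  set σ := (b : ℝ) ^ m * t.2 with hσ
  have hτ0 : 0 ≤ τ := mul_nonneg hpos.le h1.1
  have hσ0 : 0 ≤ σ := mul_nonneg hpos.le h2.1
  have hτ1 : τ < (b : ℝ) ^ m := by rw [hτ]; nlinarith [h1.2]
  have hσ1 : σ < (b : ℝ) ^ m := by rw [hσ]; nlinarith [h2.2]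
  have hk : ⌊τ⌋₊ < b ^ m := by rw [Nat.floor_lt hτ0]; exact_mod_cast hτ1
  have hl : ⌊σ⌋₊ < b ^ m := by rw [Nat.floor_lt hσ0]; exact_mod_cast hσ1
  have hval : ∀ u : ZMod b, (u.val : ℝ) / ((b : ℝ) - 1) ∈ Set.Icc (0 : ℝ) 1 := by
    intro u
    refine ⟨by positivity, ?_⟩
    rw [div_le_one hb1]
    have : (u.val : ℝ) + 1 ≤ b := by exact_mod_cast ZMod.val_lt u
    linarith
  have hcount := sum_hamSymPts hb m t
  set S := ((hamSymPts b m).map fun x =>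
        if 0 ≤ x.1 ∧ x.1 < t.1 ∧ 0 ≤ x.2 ∧ x.2 < t.2 then (1 : ℝ) else 0).sum with hS
  have hdiff : |S - (b * gridDisc b m ⌊τ⌋₊ ⌊σ⌋₊
      + (b : ℝ) ^ 2 * (⌊τ⌋₊ * ⌊σ⌋₊ / (b : ℝ) ^ m))| ≤ 4 * (b : ℝ) ^ 2 := by
    rw [hcount, ← sum_shift_grid_count]
    simp only [← Finset.sum_sub_distrib]
    refine (Finset.abs_sum_le_sum_abs _ _).trans ((Finset.sum_le_sum fun u _ =>
      (Finset.abs_sum_le_sum_abs _ _).trans (Finset.sum_le_sum fun v _ =>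
        abs_count_sub_grid_count_le m (v - u) (hval u) (hval v) hτ0 hσ0 hk.le)).trans_eq ?_)
    simp only [Finset.sum_const, Finset.card_univ, ZMod.card, nsmul_eq_mul]
    ring
  have hN : (b : ℝ) ^ (m + 2) * disc2 (hamSymPts b m) t
      = S - (b : ℝ) ^ 2 * (τ * σ / (b : ℝ) ^ m) := by
    rw [disc2, card_hamSymPts, ← hS, hτ, hσ]
    push_cast
    field_simp
    ring
  have hvol : |τ * σ / (b : ℝ) ^ m - ⌊τ⌋₊ * ⌊σ⌋₊ / (b : ℝ) ^ m| ≤ 2 := by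
    have a1 := Nat.floor_le hτ0
    have a2 := Nat.floor_le hσ0
    have a3 := Nat.lt_floor_add_one τ
    have a4 := Nat.lt_floor_add_one σ
    have a5 : (0 : ℝ) ≤ ⌊τ⌋₊ := by positivity
    have a6 : (0 : ℝ) ≤ ⌊σ⌋₊ := by positivity
    rw [← sub_div, abs_of_nonneg (div_nonneg (by nlinarith) hpos.le), div_le_iff₀ hpos]
    nlinarith
  have hF : |totalDefect b m ⌊τ⌋₊ ⌊σ⌋₊| ≤ b := abs_totalDefect_le m _ hl
  have hb2 : (0 : ℝ) ≤ (b : ℝ) ^ 2 := by positivity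
  have hF2 : |b * (totalDefect b m ⌊τ⌋₊ ⌊σ⌋₊ / 2)| ≤ (b : ℝ) ^ 2 := by
    rw [abs_mul, abs_div, abs_of_nonneg (by positivity : (0 : ℝ) ≤ b), abs_two]
    have := abs_nonneg (totalDefect b m ⌊τ⌋₊ ⌊σ⌋₊)
    nlinarith
  have hvol2 := mul_le_mul_of_nonneg_left hvol hb2
  rw [← abs_of_nonneg hb2, ← abs_mul, abs_of_nonneg hb2] at hvol2
  rw [hN, gridMart]
  rw [abs_le] at hdiff hvol2 hF2 ⊢
  constructor <;> linarith [hdiff.1, hdiff.2, hvol2.1, hvol2.2, hF2.1, hF2.2]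

end LocalDiscrepancy

/-! ### From exponential moments to `L_p` norms -/

lemma rpow_le_one_add_factorial_mul_exp {p x : ℝ} (hp : 0 ≤ p) (hx : 0 ≤ x) :
    x ^ p ≤ (1 + (⌈p⌉₊.factorial : ℝ)) * Real.exp x := by
  have hf : (0 : ℝ) ≤ ⌈p⌉₊.factorial := by positivity
  have h1 : 1 ≤ Real.exp x := Real.one_le_exp hx
  rcases le_total x 1 with h | h
  · have := Real.rpow_le_one hx h hp
    nlinarith
  · have h2 : x ^ p ≤ x ^ ⌈p⌉₊ := by
      rw [← Real.rpow_natCast]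
      exact Real.rpow_le_rpow_of_exponent_le h (Nat.le_ceil p)
    have h3 := Real.pow_div_factorial_le_exp x hx ⌈p⌉₊
    rw [div_le_iff₀ (by positivity)] at h3
    nlinarith

lemma setIntegral_unitSquare_le {n : ℕ} (hn : 0 < n) {f : ℝ × ℝ → ℝ} (g : ℕ → ℕ → ℝ)
    (hf : ∀ t, 0 ≤ f t)
    (hfg : ∀ t : ℝ × ℝ, t.1 ∈ Set.Ico (0 : ℝ) 1 → t.2 ∈ Set.Ico (0 : ℝ) 1 →
      f t ≤ g ⌊n * t.1⌋₊ ⌊n * t.2⌋₊) :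
    ∫ t in Set.Icc ((0 : ℝ), (0 : ℝ)) (1, 1), f t
      ≤ (∑ k ∈ Finset.range n, ∑ l ∈ Finset.range n, g k l) / (n : ℝ) ^ 2 := by
  have hnR : (0 : ℝ) < n := by exact_mod_cast hn
  let I : ℕ → Set ℝ := fun k => Set.Ico ((k : ℝ) / n) ((k + 1) / n)
  have hI : ∀ k, volume.real (I k) = 1 / n := fun k => by
    rw [Real.volume_real_Ico_of_le (by gcongr; linarith)]
    ring
  have hIfin : ∀ k, volume (I k) ≠ ⊤ := fun k => by simp [I]
  have hsub : ∀ k ∈ Finset.range n, I k ⊆ Set.Ico 0 1 := by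
    intro k hk x hx
    have hk' : (k : ℝ) + 1 ≤ n := by exact_mod_cast Finset.mem_range.mp hk
    refine ⟨le_trans (by positivity) hx.1, hx.2.trans_le ?_⟩
    rwa [div_le_one hnR]
  have hmem : ∀ x : ℝ, x ∈ Set.Ico (0 : ℝ) 1 → ∀ k : ℕ, x ∈ I k ↔ ⌊n * x⌋₊ = k := by
    intro x hx k
    rw [Nat.floor_eq_iff (mul_nonneg hnR.le hx.1), Set.mem_Ico, div_le_iff₀' hnR,
      lt_div_iff₀' hnR]
  have hfl : ∀ x : ℝ, x ∈ Set.Ico (0 : ℝ) 1 → ⌊n * x⌋₊ < n := by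
    intro x hx
    rw [Nat.floor_lt (mul_nonneg hnR.le hx.1)]
    nlinarith [hx.2]
  let F : ℝ × ℝ → ℝ := fun t => ∑ k ∈ Finset.range n, ∑ l ∈ Finset.range n,
    (I k ×ˢ I l).indicator (fun _ => g k l) t
  have hmeas : ∀ k l, MeasurableSet (I k ×ˢ I l) := fun k l =>
    measurableSet_Ico.prod measurableSet_Ico
  have hae : (Set.Icc ((0 : ℝ), (0 : ℝ)) (1, 1) : Set (ℝ × ℝ))
      =ᵐ[volume] (Set.Ico (0 : ℝ) 1 ×ˢ Set.Ico (0 : ℝ) 1 : Set (ℝ × ℝ)) := by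
    rw [← Set.Icc_prod_Icc, Measure.volume_eq_prod]
    exact Measure.set_prod_ae_eq Ico_ae_eq_Icc.symm Ico_ae_eq_Icc.symm
  have hint : ∀ k l, Integrable ((I k ×ˢ I l).indicator fun _ : ℝ × ℝ => g k l)
      (volume.restrict (Set.Ico (0 : ℝ) 1 ×ˢ Set.Ico (0 : ℝ) 1)) := fun k l =>
    ((integrableOn_const (by simp [Measure.volume_eq_prod, Measure.prod_prod])).indicator
      (hmeas k l))
  rw [setIntegral_congr_set hae]
  have hle : ∫ t in (Set.Ico (0 : ℝ) 1 ×ˢ Set.Ico (0 : ℝ) 1), f t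
      ≤ ∫ t in (Set.Ico (0 : ℝ) 1 ×ˢ Set.Ico (0 : ℝ) 1), F t := by
    refine integral_mono_of_nonneg (Filter.Eventually.of_forall hf)
      (integrable_finsetSum _ fun k _ => integrable_finsetSum _ fun l _ => hint k l) ?_
    refine (ae_restrict_iff' (measurableSet_Ico.prod measurableSet_Ico)).mpr
      (Filter.Eventually.of_forall fun t ht => (hfg t ht.1 ht.2).trans_eq ?_)
    have h : ∀ k l, (I k ×ˢ I l).indicator (fun _ : ℝ × ℝ => g k l) t
        = if ⌊n * t.2⌋₊ = l then (if ⌊n * t.1⌋₊ = k then g k l else 0) else 0 := by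
      intro k l
      rw [Set.indicator_apply]
      simp only [Set.mem_prod, hmem _ ht.1, hmem _ ht.2]
      by_cases h1 : ⌊n * t.1⌋₊ = k <;> by_cases h2 : ⌊n * t.2⌋₊ = l <;> simp [h1, h2]
    simp only [F, h, Finset.sum_ite_eq, Finset.mem_range, hfl _ ht.1, hfl _ ht.2, if_true]
  refine hle.trans_eq ?_
  simp only [F]
  rw [integral_finsetSum _ fun k _ => integrable_finsetSum _ fun l _ => hint k l,
    Finset.sum_div]
  refine Finset.sum_congr rfl fun k hk => ?_
  rw [integral_finsetSum _ fun l _ => hint k l, Finset.sum_div]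
  refine Finset.sum_congr rfl fun l hl => ?_
  rw [integral_indicator (hmeas k l), Measure.restrict_restrict (hmeas k l),
    Set.inter_eq_left.mpr (Set.prod_mono (hsub k hk) (hsub l hl)), setIntegral_const,
    Measure.volume_eq_prod, measureReal_prod_prod, hI, hI, smul_eq_mul]
  field_simp

end Sym

-- STATEMENT 14
theorem stmt14 (b : ℕ) (hb : b.Prime) [NeZero b] (p : ℝ) (hp : 1 ≤ p) :
    ∃ C : ℝ, 0 < C ∧ ∀ m : ℕ, 1 ≤ m →
      LpDisc p (hamSymPts b m) ≤ C * Real.sqrt ((m : ℝ) + 2) / (b : ℝ) ^ (m + 2) := by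
  have hb0 : 0 < b := hb.pos
  set A : ℝ := (1 + (⌈p⌉₊.factorial : ℝ)) * Real.exp (7 * (b : ℝ) ^ 2) with hA
  have hApos : 0 < A := by positivity
  set C₂ : ℝ := 2 * A * Real.exp (2 * (b : ℝ) ^ 4) with hC₂
  refine ⟨C₂ ^ (1 / p), by positivity, fun m _ => ?_⟩
  set r : ℝ := Real.sqrt ((m : ℝ) + 2) with hr
  have hr1 : 1 ≤ r := Real.one_le_sqrt.mpr (by linarith [(Nat.cast_nonneg m : (0 : ℝ) ≤ m)])
  have hr0 : 0 < r := by linarith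
  have hr2 : r ^ 2 = m + 2 := Real.sq_sqrt (by positivity)
  set N : ℝ := (b : ℝ) ^ (m + 2) with hN
  have hN0 : 0 < N := by positivity
  have hp0 : 0 < p := by linarith
  set s : ℝ := b / r with hs
  let g : ℕ → ℕ → ℝ := fun k l => (r / N) ^ p * (A *
    (Real.exp (s * gridMart b m k l) + Real.exp (-s * gridMart b m k l)))
  have hpt : ∀ t : ℝ × ℝ, t.1 ∈ Set.Ico (0 : ℝ) 1 → t.2 ∈ Set.Ico (0 : ℝ) 1 →
      |disc2 (hamSymPts b m) t| ^ p ≤ g ⌊((b ^ m : ℕ) : ℝ) * t.1⌋₊ ⌊((b ^ m : ℕ) : ℝ) * t.2⌋₊ := by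
    intro t ht1 ht2
    have hD := abs_disc2_sub_gridMart_le hb.one_lt m ht1 ht2
    simp only [g]
    push_cast
    set Z := gridMart b m ⌊(b : ℝ) ^ m * t.1⌋₊ ⌊(b : ℝ) ^ m * t.2⌋₊ with hZ
    set x := N * |disc2 (hamSymPts b m) t| / r with hx
    have hx0 : 0 ≤ x := by positivity
    have hxd : |disc2 (hamSymPts b m) t| = r / N * x := by
      rw [hx]; field_simp
    have hxle : x ≤ 7 * (b : ℝ) ^ 2 + |s * Z| := by
      have h1 : N * |disc2 (hamSymPts b m) t| ≤ 7 * (b : ℝ) ^ 2 + b * |Z| := by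
        have := abs_sub_abs_le_abs_sub (N * disc2 (hamSymPts b m) t) (b * Z)
        rw [abs_mul, abs_mul, abs_of_pos hN0, Nat.abs_cast] at this
        linarith
      have h2 : |s * Z| = b * |Z| / r := by
        rw [abs_mul, hs, abs_of_nonneg (by positivity)]; ring
      rw [h2, hx, div_le_iff₀ hr0, add_mul, div_mul_cancel₀ _ hr0.ne']
      have h3 : 7 * (b : ℝ) ^ 2 ≤ 7 * (b : ℝ) ^ 2 * r := le_mul_of_one_le_right (by positivity) hr1
      linarith
    rw [hxd, Real.mul_rpow (by positivity) hx0]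
    refine mul_le_mul_of_nonneg_left ?_ (by positivity)
    calc x ^ p ≤ (1 + (⌈p⌉₊.factorial : ℝ)) * Real.exp x :=
          rpow_le_one_add_factorial_mul_exp hp0.le hx0
      _ ≤ (1 + (⌈p⌉₊.factorial : ℝ)) * Real.exp (7 * (b : ℝ) ^ 2 + |s * Z|) := by gcongr
      _ = A * Real.exp |s * Z| := by rw [Real.exp_add, hA]; ring
      _ ≤ _ := by
          refine mul_le_mul_of_nonneg_left ?_ hApos.le
          rw [neg_mul]
          exact Real.exp_abs_le _
  have hmom : ∀ t : ℝ, t ^ 2 = s ^ 2 →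
      ∑ k ∈ Finset.range (b ^ m), ∑ l ∈ Finset.range (b ^ m), Real.exp (t * gridMart b m k l)
        ≤ ((b ^ m : ℕ) : ℝ) ^ 2 * Real.exp (2 * (b : ℝ) ^ 4) := by
    intro t ht
    refine (sum_exp_gridMart_le t m).trans ?_
    rw [mul_pow, ← Real.exp_nat_mul]
    push_cast
    rw [← pow_mul, ← pow_mul, mul_comm 2 m]
    refine mul_le_mul_of_nonneg_left (Real.exp_le_exp.mpr ?_) (by positivity)
    rw [mul_pow, ht, hs, div_pow, hr2]
    have hm : (m : ℝ) / (m + 2) ≤ 1 := by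
      rw [div_le_one (by positivity)]; linarith
    calc (m : ℝ) * ((b : ℝ) ^ 2 / (m + 2) * (2 * b) ^ 2 / 2)
        = 2 * (b : ℝ) ^ 4 * (m / (m + 2)) := by ring
      _ ≤ 2 * (b : ℝ) ^ 4 := mul_le_of_le_one_right (by positivity) hm
  have hint := setIntegral_unitSquare_le (n := b ^ m) (by positivity) g
    (fun t => by positivity : ∀ t, 0 ≤ |disc2 (hamSymPts b m) t| ^ p) hpt
  have hbound : ∫ t in Set.Icc ((0 : ℝ), (0 : ℝ)) (1, 1), |disc2 (hamSymPts b m) t| ^ p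
      ≤ (r / N) ^ p * C₂ := by
    refine hint.trans ?_
    rw [div_le_iff₀ (by positivity)]
    simp only [g, ← Finset.mul_sum, Finset.sum_add_distrib]
    rw [mul_assoc _ C₂]
    refine mul_le_mul_of_nonneg_left ?_ (by positivity : 0 ≤ (r / N) ^ p)
    refine (mul_le_mul_of_nonneg_left
      (add_le_add (hmom s rfl) (hmom (-s) (neg_sq s))) hApos.le).trans_eq ?_
    rw [hC₂]
    ring
  rw [LpDisc]
  calc _ ≤ ((r / N) ^ p * C₂) ^ (1 / p) := by
        refine Real.rpow_le_rpow (integral_nonneg fun t => by positivity) hbound (by positivity)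
    _ = C₂ ^ (1 / p) * r / N := by
        rw [Real.mul_rpow (by positivity) (by positivity), ← Real.rpow_mul (by positivity),
          mul_one_div_cancel hp0.ne', Real.rpow_one]
        ring

end
end
end

section
/- Let b be a prime, and let m, n ∈ ℕ with n ≥ m. Let P be the two-dimensional digital net over ℤ_b with generating matrices C₁, C₂ ∈ ℤ_b^{n×m} (viewed as ℕ×m matrices whose rows beyond row n are zero). For j = 1,2 and l ≥ 1, let c_{j,l} be the l-th row of C_j (the zero vector for l > n). Suppose ρ is a positive integer such that for all v₁, v₂ ∈ ℕ₀ and all indices 1 ≤ i_{1,v₁} < ⋯ < i_{1,1} ≤ 2m and 1 ≤ i_{2,v₂} < ⋯ < i_{2,1} ≤ 2m with ∑_{l=1}^{min(v₁,2)} i_{1,l} + ∑_{l=1}^{min(v₂,2)} i_{2,l} ≤ ρ, the vectors c_{1,i_{1,v₁}},…,c_{1,i_{1,1}}, c_{2,i_{2,v₂}},…,c_{2,i_{2,1}} are linearly independent over ℤ_b. Then the minimum Dick weight satisfies ρ₂(P) > ρ. -/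
open MeasureTheory

noncomputable section

open MeasureTheory Sym

open scoped Classical

noncomputable section

namespace Sym

lemma zdgt_eq_zero_of_lt_s15 {b k i : ℕ} (h : k < b ^ i) : zdgt b k i = 0 := by
  simp [zdgt, dgt, Nat.div_eq_of_lt h]

lemma zdgt_mod_pow {b k i L : ℕ} (hb : 0 < b) (hi : i < L) :
    zdgt b (k % b ^ L) i = zdgt b k i := by
  obtain ⟨d, rfl⟩ := Nat.exists_eq_add_of_lt hi
  have h : k = k % b ^ (i + d + 1) + b ^ i * (b * (b ^ d * (k / b ^ (i + d + 1)))) := by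
    conv_lhs => rw [← Nat.mod_add_div k (b ^ (i + d + 1))]
    ring
  unfold zdgt dgt
  conv_rhs => rw [h, Nat.add_mul_div_left _ _ (pow_pos hb i), Nat.add_mul_mod_self_left]

lemma zdgt_log_ne_zero {b k : ℕ} (hb : 1 < b) (hk : k ≠ 0) :
    zdgt b k (Nat.log b k) ≠ 0 := by
  have hlt : k / b ^ Nat.log b k < b := by
    rw [Nat.div_lt_iff_lt_mul (by positivity), ← pow_succ']
    exact Nat.lt_pow_succ_log_self hb k
  have hpos : 0 < k / b ^ Nat.log b k :=
    Nat.div_pos (Nat.pow_log_le_self b hk) (by positivity)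
  rw [zdgt, dgt, Nat.mod_eq_of_lt hlt, Ne, ZMod.natCast_eq_zero_iff]
  exact fun h => absurd (Nat.le_of_dvd hpos h) (by omega)

/-- The positions `a₁ > a₂ > a₂ - 1 > ⋯ > 1` cover all nonzero digits of `k`, where `a₁` and
`a₂` are the positions of its two highest nonzero digits. -/
lemma exists_strictAnti_covering_digits {b : ℕ} (hb : 1 < b) (k : ℕ) :
    ∃ (v : ℕ) (i : Fin v → ℕ), StrictAnti i ∧ (∀ l, 1 ≤ i l ∧ i l ≤ mu2 b k) ∧
      (∑ l ∈ Finset.univ.filter fun l : Fin v => (l : ℕ) < 2, i l) = mu2 b k ∧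
      (∀ c : ℕ → ZMod b, ∑ l, zdgt b k (i l - 1) * c (i l - 1) =
        ∑ j ∈ Finset.range k, zdgt b k j * c j) ∧
      (k ≠ 0 → ∃ l, zdgt b k (i l - 1) ≠ 0) := by
  rcases eq_or_ne k 0 with rfl | hk
  · exact ⟨0, Fin.elim0, fun l => l.elim0, fun l => l.elim0, by simp [mu2], by simp, by simp⟩
  set L := Nat.log b k with hL
  set r := k % b ^ L with hr
  obtain ⟨a, ha⟩ : ∃ a, a = if r = 0 then 0 else Nat.log b r + 1 := ⟨_, rfl⟩
  have hmu : mu2 b k = L + 1 + a := by simp [mu2, hk, ha, hr, hL]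
  have hra : r < b ^ a := by
    rw [ha]
    split_ifs with h
    · simp [h]
    · exact Nat.lt_pow_succ_log_self hb r
  have haL : a < L + 1 := by
    rw [ha]
    split_ifs with h
    · omega
    · have := Nat.log_lt_of_lt_pow h (Nat.mod_lt k (pow_pos (by omega : 0 < b) L))
      omega
  have hLk : L < k := Nat.log_lt_self b hk
  have hanti : StrictAnti fun l : Fin (a + 1) => if (l : ℕ) = 0 then L + 1 else a + 1 - l := by
    intro x y hxy
    have := Fin.lt_def.mp hxy
    have := y.isLt
    dsimp only
    split_ifs <;> omega
  have hone : ∀ l : Fin (a + 1), 1 ≤ if (l : ℕ) = 0 then L + 1 else a + 1 - (l : ℕ) := by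
    intro l
    have := l.isLt
    split_ifs <;> omega
  refine ⟨a + 1, _, hanti, fun l => ⟨hone l, ?_⟩, ?_, fun c => ?_, fun _ => ⟨0, ?_⟩⟩
  · rw [hmu]
    split_ifs <;> omega
  · rw [hmu, Finset.sum_filter, Fin.sum_univ_succ]
    cases a with
    | zero => simp
    | succ a => simp
  · refine Finset.sum_of_injOn
      (fun l : Fin (a + 1) => (if (l : ℕ) = 0 then L + 1 else a + 1 - (l : ℕ)) - 1) ?_ ?_ ?_ fun _ _ => rfl
    · intro x _ y _ hxy
      have := hone x
      have := hone y
      exact hanti.injective (by dsimp only at hxy ⊢; omega)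
    · intro x _
      simp only [Finset.coe_range, Set.mem_Iio]
      split_ifs <;> omega
    · intro j _ hj
      have hjL : j ≠ L := by
        rintro rfl
        exact hj ⟨0, by simp, by simp⟩
      have haj : a ≤ j := by
        by_contra! h
        refine hj ⟨⟨a - j, by omega⟩, by simp, ?_⟩
        dsimp only
        split_ifs <;> omega
      suffices zdgt b k j = 0 by rw [this, zero_mul]
      rcases lt_or_gt_of_ne hjL with h | h
      · rw [← zdgt_mod_pow (by omega) h]
        exact zdgt_eq_zero_of_lt_s15 (hra.trans_le (Nat.pow_le_pow_right (by omega) haj))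
      · exact zdgt_eq_zero_of_lt_s15 (Nat.lt_pow_of_log_lt hb h)
  · simpa using zdgt_log_ne_zero hb hk

end Sym

-- STATEMENT 15
theorem stmt15 (b : ℕ) (hb : b.Prime) (m n : ℕ) (hm : 1 ≤ m) (hmn : m ≤ n)
    (C₁ C₂ : ℕ → Fin m → ZMod b)
    (hrows : ∀ l, n ≤ l → (∀ t, C₁ l t = 0) ∧ ∀ t, C₂ l t = 0)
    (ρ : ℕ) (hρ : 1 ≤ ρ)
    (hindep : ∀ (v₁ v₂ : ℕ) (i₁ : Fin v₁ → ℕ) (i₂ : Fin v₂ → ℕ),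
      StrictAnti i₁ → StrictAnti i₂ →
      (∀ l, 1 ≤ i₁ l ∧ i₁ l ≤ 2 * m) → (∀ l, 1 ≤ i₂ l ∧ i₂ l ≤ 2 * m) →
      (∑ l ∈ Finset.univ.filter fun l : Fin v₁ => (l : ℕ) < 2, i₁ l)
          + (∑ l ∈ Finset.univ.filter fun l : Fin v₂ => (l : ℕ) < 2, i₂ l) ≤ ρ →
      LinearIndependent (ZMod b)
        (Sum.elim (fun l : Fin v₁ => C₁ (i₁ l - 1)) (fun l : Fin v₂ => C₂ (i₂ l - 1)))) :
    ∀ k : Fin 2 → ℕ, inDual b m 2 ![C₁, C₂] k → k ≠ 0 →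
      ρ < mu2 b (k 0) + mu2 b (k 1) := by
  have : Fact b.Prime := ⟨hb⟩
  have hρm : ρ ≤ 2 * m := by
    by_contra! h
    have hli := hindep (m + 1) 0 (fun l => m + 1 - l) Fin.elim0
      (fun x y hxy => by
        have := Fin.lt_def.mp hxy
        have := y.isLt
        dsimp only
        omega)
      (fun l => l.elim0) (fun l => by have := l.isLt; omega) (fun l => l.elim0)
      (by
        rw [Finset.sum_filter, Fin.sum_univ_succ]
        obtain ⟨m, rfl⟩ := Nat.exists_eq_add_of_le' hm
        simp
        omega)
    simpa using hli.fintype_card_le_finrank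
  intro k hk hk0
  by_contra! hle
  obtain ⟨v₁, i₁, anti₁, bd₁, sum₁, dig₁, ne₁⟩ :=
    exists_strictAnti_covering_digits hb.one_lt (k 0)
  obtain ⟨v₂, i₂, anti₂, bd₂, sum₂, dig₂, ne₂⟩ :=
    exists_strictAnti_covering_digits hb.one_lt (k 1)
  have hli := hindep v₁ v₂ i₁ i₂ anti₁ anti₂
    (fun l => ⟨(bd₁ l).1, by have := (bd₁ l).2; omega⟩)
    (fun l => ⟨(bd₂ l).1, by have := (bd₂ l).2; omega⟩) (by rw [sum₁, sum₂]; exact hle)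
  have hzero := Fintype.linearIndependent_iff.mp hli
    (Sum.elim (fun l => zdgt b (k 0) (i₁ l - 1)) fun l => zdgt b (k 1) (i₂ l - 1)) (by
      ext t
      have ht := hk t
      simp only [Fin.sum_univ_two, Matrix.cons_val_zero, Matrix.cons_val_one] at ht
      simpa [Fintype.sum_sum_type, Finset.sum_apply, dig₁ fun j => C₁ j t,
        dig₂ fun j => C₂ j t] using ht)
  refine hk0 (funext fun j => ?_)
  fin_cases j
  · by_contra h
    obtain ⟨l, hl⟩ := ne₁ h
    exact hl (hzero (Sum.inl l))
  · by_contra h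
    obtain ⟨l, hl⟩ := ne₂ h
    exact hl (hzero (Sum.inr l))
end
end
end

section
/- Let b be a prime and m, n ∈ ℕ with n > 2m. Let C₁, C₂ ∈ ℤ_b^{n×(m+2)} be given by (C₁)_{l,j} = 1 if (j = l and l ≤ m) or j = m+1, and 0 otherwise; (C₂)_{l,j} = 1 if (j = m+1−l and l ≤ m) or j = m+2, and 0 otherwise. For j = 1,2 and 1 ≤ l ≤ n, let c_{j,l} denote the l-th row of C_j. Then the following sets of vectors are linearly independent over ℤ_b: (1) {c_{1,1},…,c_{1,r}, c_{2,1},…,c_{2,m+1−r}} for every 0 ≤ r ≤ m+1; (2) {c_{1,1},…,c_{1,m+1}, c_{2,r}} and {c_{2,1},…,c_{2,m+1}, c_{1,r}} for every 1 ≤ r ≤ m; (3) {c_{1,1},…,c_{1,r}, c_{2,1},…,c_{2,m−r}, c_{j,s}} for every j ∈ {1,2}, 0 ≤ r ≤ m, and m+1 ≤ s ≤ n; (4) {c_{1,1},…,c_{1,r_{1,2}}, c_{1,r_{1,1}}, c_{2,1},…,c_{2,r_{2,2}}, c_{2,r_{2,1}}} for all 0 < r_{1,2} < r_{1,1} ≤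 m and 0 < r_{2,2} < r_{2,1} ≤ m with r_{1,1} + r_{1,2} + r_{2,1} + r_{2,2} ≤ 2m+1. -/
open MeasureTheory

noncomputable section

open MeasureTheory Sym

open scoped Classical

noncomputable section

theorem Sym.coeff_eq_zero_of_columns {F ι κ : Type*} [AddCommGroup F] [Fintype ι] [Fintype κ]
    {m p q : ℕ} {f : ι → ℕ} {g : κ → ℕ} {u : ι → F} {v : κ → F}
    (hf : Function.Injective f) (hg : Function.Injective g)
    (hf1 : ∀ i, 1 ≤ f i) (hg1 : ∀ k, 1 ≤ g k)
    (hfp : ∀ i, f i ≠ p → f i ≤ m) (hgq : ∀ k, g k ≠ q → g k ≤ m)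
    (hcol : ∀ i k, f i + g k = m + 1 → g k = q)
    (huv : ∀ x y, 1 ≤ x → 1 ≤ y → x + y = m + 1 →
      (∑ i, if f i = x then u i else 0) + (∑ k, if g k = y then v k else 0) = 0)
    (hu : ∑ i, u i = 0) (hv : ∑ k, v k = 0) : (∀ i, u i = 0) ∧ ∀ k, v k = 0 := by
  have hv_ne : ∀ k, g k ≠ q → v k = 0 := by
    intro k hk
    have hkm := hgq k hk
    have hk1 := hg1 k
    have h := huv (m + 1 - g k) (g k) (by omega) hk1 (by omega)
    rw [Finset.sum_eq_zero, zero_add, Finset.sum_eq_single k] at h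
    · simpa using h
    · intro k' _ hne
      exact if_neg fun he => hne (hg he)
    · simp
    · intro i _
      exact if_neg fun he => hk (hcol i k (by omega))
  have hv0 : ∀ k, v k = 0 := by
    intro k
    by_cases hk : g k = q
    · rw [Finset.sum_eq_single k] at hv
      · exact hv
      · intro k' _ hne
        exact hv_ne k' fun he => hne (hg (he.trans hk.symm))
      · simp
    · exact hv_ne k hk
  have hu_ne : ∀ i, f i ≠ p → u i = 0 := by
    intro i hi
    have him := hfp i hi
    have hi1 := hf1 i
    have h := huv (f i) (m + 1 - f i) hi1 (by omega) (by omega)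
    rw [Finset.sum_eq_single i, Finset.sum_eq_zero, add_zero] at h
    · simpa using h
    · intro k _
      simp [hv0 k]
    · intro i' _ hne
      exact if_neg fun he => hne (hf he)
    · simp
  refine ⟨fun i => ?_, hv0⟩
  by_cases hi : f i = p
  · rw [Finset.sum_eq_single i] at hu
    · exact hu
    · intro i' _ hne
      exact hu_ne i' fun he => hne (hf (he.trans hi.symm))
    · simp
  · exact hu_ne i hi

/-- Rows of `C₁` with indices `f i` and rows of `C₂` with indices `g k` are linearly independent
if at most one index on each side exceeds `m`, and all pairs of rows which share one of the
first `m` columns have a common member that is the exceptional row of its side. -/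
theorem Sym.linearIndependent_hamRow1_hamRow2 {b m : ℕ} {ι κ : Type*} [Fintype ι] [Fintype κ]
    (p q : ℕ) {f : ι → ℕ} {g : κ → ℕ}
    (hf : Function.Injective f) (hg : Function.Injective g)
    (hf1 : ∀ i, 1 ≤ f i) (hg1 : ∀ k, 1 ≤ g k)
    (hfp : ∀ i, f i ≠ p → f i ≤ m) (hgq : ∀ k, g k ≠ q → g k ≤ m)
    (hcol : (∀ i k, f i + g k = m + 1 → g k = q) ∨ ∀ i k, f i + g k = m + 1 → f i = p) :
    LinearIndependent (ZMod b)
      (Sum.elim (fun i => hamRow1 b m (f i)) (fun k => hamRow2 b m (g k))) := by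
  rw [Fintype.linearIndependent_iff]
  intro c hc
  have hc' : ∀ j, (∑ i, c (Sum.inl i) * hamRow1 b m (f i) j) +
      ∑ k, c (Sum.inr k) * hamRow2 b m (g k) j = 0 := by
    intro j
    have := congrFun hc j
    simpa [Fintype.sum_sum_type] using this
  have hu : ∑ i, c (Sum.inl i) = 0 := by
    have := hc' ⟨m, by omega⟩
    have h2 : ∀ k, hamRow2 b m (g k) ⟨m, by omega⟩ = 0 := by
      intro k
      have := hg1 k
      simp only [hamRow2]
      exact if_neg (by omega)
    simpa [hamRow1, h2] using this
  have hv : ∑ k, c (Sum.inr k) = 0 := by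
    have := hc' ⟨m + 1, by omega⟩
    have h1 : ∀ i, hamRow1 b m (f i) ⟨m + 1, by omega⟩ = 0 := by
      intro i
      simp only [hamRow1]
      exact if_neg (by omega)
    simpa [hamRow2, h1] using this
  have huv : ∀ x y, 1 ≤ x → 1 ≤ y → x + y = m + 1 →
      (∑ i, if f i = x then c (Sum.inl i) else 0) +
        (∑ k, if g k = y then c (Sum.inr k) else 0) = 0 := by
    intro x y hx hy hxy
    refine Eq.trans ?_ (hc' ⟨x - 1, by omega⟩)
    congr 1
    · refine Finset.sum_congr rfl fun i _ => ?_
      simp only [hamRow1, mul_ite, mul_one, mul_zero]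
      exact if_congr (by omega) rfl rfl
    · refine Finset.sum_congr rfl fun k _ => ?_
      have := hg1 k
      simp only [hamRow2, mul_ite, mul_one, mul_zero]
      exact if_congr (by omega) rfl rfl
  rcases hcol with hcol | hcol
  · obtain ⟨h1, h2⟩ := coeff_eq_zero_of_columns hf hg hf1 hg1 hfp hgq hcol huv hu hv
    rintro (i | k)
    exacts [h1 i, h2 k]
  · obtain ⟨h2, h1⟩ := coeff_eq_zero_of_columns hg hf hg1 hf1 hgq hfp
      (fun k i h => hcol i k (by omega))
      (fun x y hx hy hxy => by rw [add_comm]; exact huv y x hy hx (by omega)) hv hu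
    rintro (i | k)
    exacts [h1 i, h2 k]

theorem Sym.injective_val_add_one (r : ℕ) : Function.Injective fun i : Fin r => (i : ℕ) + 1 :=
  fun i j h => Fin.ext (by simpa using h)

theorem Sym.injective_sumElim_val_add_one {r s : ℕ} (hrs : r < s) :
    Function.Injective (Sum.elim (fun i : Fin r => (i : ℕ) + 1) (fun _ : Fin 1 => s)) :=
  (injective_val_add_one r).sumElim (Function.injective_of_subsingleton _)
    fun i _ => by have := i.isLt; omega

-- STATEMENT 17
theorem stmt17 (b : ℕ) (hb : b.Prime) (m n : ℕ) (hm : 1 ≤ m) (hn : 2 * m < n) :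
    (∀ r : ℕ, r ≤ m + 1 →
      LinearIndependent (ZMod b)
        (Sum.elim (fun i : Fin r => hamRow1 b m ((i : ℕ) + 1))
          (fun i : Fin (m + 1 - r) => hamRow2 b m ((i : ℕ) + 1))))
    ∧ (∀ r : ℕ, 1 ≤ r → r ≤ m →
      LinearIndependent (ZMod b)
        (Sum.elim (fun i : Fin (m + 1) => hamRow1 b m ((i : ℕ) + 1))
          (fun _ : Fin 1 => hamRow2 b m r))
      ∧ LinearIndependent (ZMod b)
        (Sum.elim (fun i : Fin (m + 1) => hamRow2 b m ((i : ℕ) + 1))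
          (fun _ : Fin 1 => hamRow1 b m r)))
    ∧ (∀ j : Fin 2, ∀ r s : ℕ, r ≤ m → m + 1 ≤ s → s ≤ n →
      LinearIndependent (ZMod b)
        (Sum.elim
          (Sum.elim (fun i : Fin r => hamRow1 b m ((i : ℕ) + 1))
            (fun i : Fin (m - r) => hamRow2 b m ((i : ℕ) + 1)))
          (fun _ : Fin 1 => hamRow b m j s)))
    ∧ (∀ r11 r12 r21 r22 : ℕ, 0 < r12 → r12 < r11 → r11 ≤ m →
        0 < r22 → r22 < r21 → r21 ≤ m → r11 + r12 + r21 + r22 ≤ 2 * m + 1 →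
      LinearIndependent (ZMod b)
        (Sum.elim
          (Sum.elim (fun i : Fin r12 => hamRow1 b m ((i : ℕ) + 1))
            (fun _ : Fin 1 => hamRow1 b m r11))
          (Sum.elim (fun i : Fin r22 => hamRow2 b m ((i : ℕ) + 1))
            (fun _ : Fin 1 => hamRow2 b m r21)))) := by
  refine ⟨fun r hr => ?_, fun r hr1 hrm => ⟨?_, ?_⟩, fun j r s hr hs _ => ?_, ?_⟩
  · refine linearIndependent_hamRow1_hamRow2 r (m + 1 - r) (injective_val_add_one _)
      (injective_val_add_one _) ?_ ?_ ?_ ?_ (Or.inl ?_) <;> intros <;> omega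
  · refine linearIndependent_hamRow1_hamRow2 (g := fun _ : Fin 1 => r) (m + 1) r
      (injective_val_add_one _) (Function.injective_of_subsingleton _)
      ?_ ?_ ?_ ?_ (Or.inl ?_) <;> intros <;> omega
  · have h : LinearIndependent (ZMod b)
        (Sum.elim (fun _ : Fin 1 => hamRow1 b m r)
          (fun i : Fin (m + 1) => hamRow2 b m ((i : ℕ) + 1))) := by
      refine linearIndependent_hamRow1_hamRow2 (f := fun _ : Fin 1 => r) r (m + 1)
        (Function.injective_of_subsingleton _) (injective_val_add_one _)
        ?_ ?_ ?_ ?_ (Or.inr ?_) <;> intros <;> omega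
    refine (linearIndependent_equiv' (Equiv.sumComm _ _) ?_).2 h
    ext (i | i) <;> rfl
  · fin_cases j
    · have h := linearIndependent_hamRow1_hamRow2 (b := b) (m := m) s 0
        (injective_sumElim_val_add_one (show r < s by omega)) (injective_val_add_one (m - r))
        (by rintro (i | i) <;> simp only [Sum.elim_inl, Sum.elim_inr] <;> omega) (by omega)
        (by rintro (i | i) <;> simp only [Sum.elim_inl, Sum.elim_inr] <;> omega) (by omega)
        (Or.inl (by rintro (i | i) <;> simp only [Sum.elim_inl, Sum.elim_inr] <;> omega))
      refine (linearIndependent_equiv' ((Equiv.sumAssoc _ _ _).trans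
        (((Equiv.refl _).sumCongr (Equiv.sumComm _ _)).trans (Equiv.sumAssoc _ _ _).symm)) ?_).2 h
      ext ((i | i) | i) <;> rfl
    · have h := linearIndependent_hamRow1_hamRow2 (b := b) (m := m) 0 s
        (injective_val_add_one r) (injective_sumElim_val_add_one (show m - r < s by omega))
        (by omega) (by rintro (i | i) <;> simp only [Sum.elim_inl, Sum.elim_inr] <;> omega)
        (by omega) (by rintro (i | i) <;> simp only [Sum.elim_inl, Sum.elim_inr] <;> omega)
        (Or.inl (by rintro i (k | k) <;> simp only [Sum.elim_inl, Sum.elim_inr] <;> omega))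
      refine (linearIndependent_equiv' (Equiv.sumAssoc _ _ _) ?_).2 h
      ext ((i | i) | i) <;> rfl
  · intro r11 r12 r21 r22 h1 h2 h3 h4 h5 h6 h7
    have h8 : r12 + r22 + 1 ≤ m := by omega
    have h := linearIndependent_hamRow1_hamRow2 (b := b) (m := m) r11 r21
      (injective_sumElim_val_add_one h2) (injective_sumElim_val_add_one h5)
      (by rintro (i | i) <;> simp only [Sum.elim_inl, Sum.elim_inr] <;> omega)
      (by rintro (i | i) <;> simp only [Sum.elim_inl, Sum.elim_inr] <;> omega)
      (by rintro (i | i) <;> simp only [Sum.elim_inl, Sum.elim_inr] <;> omega)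
      (by rintro (i | i) <;> simp only [Sum.elim_inl, Sum.elim_inr] <;> omega)
      (by
        by_cases hc : m + 1 ≤ r11 + r22
        · right
          have h9 : r12 + r21 ≤ m := by omega
          rintro (i | i) (k | k) h <;>
            first | rfl | (simp only [Sum.elim_inl, Sum.elim_inr] at h ⊢; omega)
        · left
          rintro (i | i) (k | k) h <;>
            first | rfl | (simp only [Sum.elim_inl, Sum.elim_inr] at h ⊢; omega))
    convert h using 1
    ext ((i | i) | (i | i)) <;> rfl

end
end
end
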